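/- arXiv:2003.06178 — 2 statements merged into one kernel-verified Lean document; each statement's English description precedes it below -/
import Mathlib

section
/- Let D be a rooted digraph with root r and w ≠ r with rw not an edge of D. Suppose I ∈ 𝒢_D(w) is such that I+f ∈ 𝒢_D(w) for every f ∈ in_D(w)\I. Assume there is an edge uv ∈ E(D) with u ≠ r and v ≠ w such that I ∉ 𝒢_{D−uv}(w). Then there exists a vertex set S ⊆ V(D)−r containing v and an (r,S)-path-system 𝒫 with terminal-vertex set exactly S, such that S separates the tails of all edges in in_D(v)−uv from r; in particular uv is the last edge of some path in 𝒫. -/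
/-!  Common framework: digraphs as edge sets on a vertex type, directed paths,
path-systems, separations, flames and largeness. -/

universe u

variable {V : Type u}

/-- A directed path in the digraph on `V` with edge set `E`, given by its
(nonempty, repetition-free) list of vertices `start :: rest`. -/
structure Dipath (E : Set (V × V)) : Type u where
  start : V
  rest : List V
  chain : List.Chain (fun a b => (a, b) ∈ E) start rest
  nodup : (start :: rest).Nodup

namespace Dipath

variable {E : Set (V × V)}

/-- The list of vertices of the path. -/
def verts (p : Dipath E) : List V := p.start :: p.rest

/-- The terminal vertex of the path. -/
def last (p : Dipath E) : V := (p.start :: p.rest).getLast (List.cons_ne_nil _ _)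

/-- The set of vertices of the path. -/
def support (p : Dipath E) : Set V := {v | v ∈ p.verts}

/-- The internal vertices of the path (all vertices except the first and the last). -/
def internal (p : Dipath E) : Set V := {v | v ∈ p.rest.dropLast}

/-- The list of (directed) edges of the path. -/
def edges (p : Dipath E) : List (V × V) := p.verts.zip p.rest

/-- The set of edges of the path. -/
def edgeSet (p : Dipath E) : Set (V × V) := {e | e ∈ p.edges}

/-- The last edge of the path, if the path has at least one edge. -/
def lastEdge? (p : Dipath E) : Option (V × V) := p.edges.getLast?

end Dipath

section Defs

variable (E : Set (V × V))

/-- The set of ingoing edges of `v`. -/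
def inEdges (v : V) : Set (V × V) := {e ∈ E | e.2 = v}

/-- The set of initial vertices of a set of paths. -/
def initVerts {E : Set (V × V)} (P : Set (Dipath E)) : Set V := Dipath.start '' P

/-- The set of terminal vertices of a set of paths. -/
def termVerts {E : Set (V × V)} (P : Set (Dipath E)) : Set V := Dipath.last '' P

/-- The set of terminal edges of a set of paths. -/
def termEdges {E : Set (V × V)} (P : Set (Dipath E)) : Set (V × V) :=
  {e | ∃ p ∈ P, p.lastEdge? = some e}

/-- An `(r,v)`-path-system: a set of pairwise internally disjoint directed
paths from `r` to `v`. -/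
def IsRVSystem (r v : V) (P : Set (Dipath E)) : Prop :=
  (∀ p ∈ P, p.start = r ∧ p.last = v) ∧
    P.Pairwise fun p q => p.support ∩ q.support ⊆ {r, v}

/-- An `(r,v)`-separation: a set of vertices avoiding `r` and `v` and meeting
every directed path from `r` to `v`. -/
def IsSeparation (r v : V) (S : Set V) : Prop :=
  r ∉ S ∧ v ∉ S ∧ ∀ p : Dipath E, p.start = r → p.last = v → (p.support ∩ S).Nonempty

/-- A set of paths `P` and a vertex set `S` are orthogonal:  every path of `P`
meets `S` in exactly one vertex and every vertex of `S` lies on a path of `P`. -/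
def Orthogonal {E : Set (V × V)} (P : Set (Dipath E)) (S : Set V) : Prop :=
  (∀ p ∈ P, ∃! x, x ∈ p.support ∩ S) ∧ ∀ x ∈ S, ∃ p ∈ P, x ∈ p.support

/-- An Erdős–Menger `(r,v)`-path-system: one orthogonal to some `(r,v)`-separation. -/
def IsEMSystem (r v : V) (P : Set (Dipath E)) : Prop :=
  IsRVSystem E r v P ∧ ∃ S, IsSeparation E r v S ∧ Orthogonal P S

/-- An Erdős–Menger `(r,v)`-separation: one orthogonal to some `(r,v)`-path-system. -/
def IsEMSeparation (r v : V) (S : Set V) : Prop :=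
  IsSeparation E r v S ∧ ∃ P : Set (Dipath E), IsRVSystem E r v P ∧ Orthogonal P S

/-- `𝒢_E(v)` (with root `r`): the collection of edge sets `I` that arise as the set of
terminal edges of an internally disjoint `(r,v)`-path-system in `E`. -/
def GSet (r v : V) : Set (Set (V × V)) :=
  {I | ∃ P : Set (Dipath E), IsRVSystem E r v P ∧ termEdges P = I}

/-- A vertex-flame (with root `r`): for every `v ≠ r`, the whole in-edge set of `v`
is the terminal edge set of an internally disjoint `(r,v)`-path-system. -/
def IsFlame (r : V) : Prop := ∀ v, v ≠ r → inEdges E v ∈ GSet E r v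

/-- `L` is `v`-large with respect to the digraph `E` rooted at `r`: `L` contains `rv`
whenever `E` does, and some Erdős–Menger `(r,v)`-path-system of `E - rv` lies in `L`. -/
def VLarge (r : V) (L : Set (V × V)) (v : V) : Prop :=
  ((r, v) ∈ E → (r, v) ∈ L) ∧
    ∃ P : Set (Dipath (E \ {(r, v)})),
      IsEMSystem (E \ {(r, v)}) r v P ∧ ∀ p ∈ P, p.edgeSet ⊆ L

/-- `L` is large with respect to the digraph `E` rooted at `r`. -/
def Large (r : V) (L : Set (V × V)) : Prop := ∀ v, v ≠ r → VLarge E r L v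

/-- An `(X,Y)`-path: from `X` to `Y`, internally disjoint from `X ∪ Y`. -/
def IsXYPath (X Y : Set V) (p : Dipath E) : Prop :=
  p.start ∈ X ∧ p.last ∈ Y ∧ ∀ w ∈ p.internal, w ∉ X ∪ Y

/-- An `(X,Y)`-path-system: pairwise disjoint `(X,Y)`-paths. -/
def IsXYSystem (X Y : Set V) (P : Set (Dipath E)) : Prop :=
  (∀ p ∈ P, IsXYPath E X Y p) ∧ P.Pairwise fun p q => Disjoint p.support q.support

/-- `X` is joinable to `Y`: some `(X,Y)`-path-system covers `X` with its initial vertices. -/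
def Joinable (X Y : Set V) : Prop :=
  ∃ P : Set (Dipath E), IsXYSystem E X Y P ∧ initVerts P = X

/-- `X` is incompressible to `Y`: `X` is joinable to `Y` and every witnessing
path-system covers `Y` with its terminal vertices. -/
def Incompressible (X Y : Set V) : Prop :=
  Joinable E X Y ∧
    ∀ P : Set (Dipath E), IsXYSystem E X Y P → initVerts P = X → termVerts P = Y

/-- An `(X,Y)`-separation: a vertex set meeting every `(X,Y)`-path. -/
def IsXYSeparation (X Y : Set V) (S : Set V) : Prop :=
  ∀ p : Dipath E, IsXYPath E X Y p → (p.support ∩ S).Nonempty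

/-- An Erdős–Menger `(X,Y)`-separation: one orthogonal to some `(X,Y)`-path-system. -/
def IsEMXYSeparation (X Y : Set V) (S : Set V) : Prop :=
  IsXYSeparation E X Y S ∧ ∃ P : Set (Dipath E), IsXYSystem E X Y P ∧ Orthogonal P S

/-- `X'` is `(X,Y)`-finitely extendable: every `O` with `X' ⊆ O ⊆ X` and `O \ X'`
finite is joinable to `Y`. -/
def FinExtendable (X Y X' : Set V) : Prop :=
  X' ⊆ X ∧ ∀ O, X' ⊆ O → O ⊆ X → (O \ X').Finite → Joinable E O Y

/-- `S` separates the vertex `y` from `r`:  every directed path from `r` to `y` meets `S`. -/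
def SeparatesFrom (r : V) (S : Set V) (y : V) : Prop :=
  ∀ p : Dipath E, p.start = r → p.last = y → (p.support ∩ S).Nonempty

/-- An `(X,y)`-path: from a vertex of `X` to `y`, internally disjoint from `X`. -/
def IsXyPath (X : Set V) (y : V) (p : Dipath E) : Prop :=
  p.start ∈ X ∧ p.last = y ∧ ∀ w ∈ p.internal, w ∉ X

/-- An `(X,y)`-path-system: `(X,y)`-paths, pairwise disjoint except possibly at `y`. -/
def IsXySystem (X : Set V) (y : V) (P : Set (Dipath E)) : Prop :=
  (∀ p ∈ P, IsXyPath E X y p) ∧ P.Pairwise fun p q => p.support ∩ q.support ⊆ {y}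

/-- An `(r,S)`-path: from `r` to a vertex of `S`, internally disjoint from `S`. -/
def IsRSPath (r : V) (S : Set V) (p : Dipath E) : Prop :=
  p.start = r ∧ p.last ∈ S ∧ ∀ w ∈ p.internal, w ∉ S

/-- An `(r,S)`-path-system: `(r,S)`-paths, pairwise disjoint apart from `r`. -/
def IsRSSystem (r : V) (S : Set V) (P : Set (Dipath E)) : Prop :=
  (∀ p ∈ P, IsRSPath E r S p) ∧ P.Pairwise fun p q => p.support ∩ q.support ⊆ {r}

/-- `E` is a `G`-quasi-flame (with root `r`): for every `v ≠ r`, every set `I` of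
ingoing edges of `v` with `I \ inEdges G v` finite lies in `𝒢_E(v)`. -/
def QuasiFlame (r : V) (G : Set (V × V)) : Prop :=
  ∀ v, v ≠ r → ∀ I, I ⊆ inEdges E v → (I \ inEdges G v).Finite → I ∈ GSet E r v

/-- The local connectivity `κ_E(r,v)`: the maximum size of an internally disjoint
`(r,v)`-path-system. -/
noncomputable def kappa (r v : V) : ℕ :=
  sSup {n | ∃ P : Set (Dipath E), IsRVSystem E r v P ∧ P.Finite ∧ P.ncard = n}

end Defs

/-- Reachability along the edge set `F`. -/
abbrev Rch (F : Set (V × V)) : V → V → Prop := Relation.ReflTransGen (fun a b => (a, b) ∈ F)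

/-- Edge sets with in- and out-degree at most one away from the root. -/
structure Sys (F : Set (V × V)) (r : V) : Prop where
  inj : ∀ a b c, (a, c) ∈ F → (b, c) ∈ F → a = b
  out : ∀ a b c, a ≠ r → (a, b) ∈ F → (a, c) ∈ F → b = c
  nr : ∀ a, (a, r) ∉ F

/-- `F` links the root to all of `T`. -/
structure Lk (E : Set (V × V)) (r : V) (F : Set (V × V)) (T : Set V) : Prop where
  sub : F ⊆ E
  sys : Sys F r
  rch : ∀ t ∈ T, Rch F r t
  noout : ∀ t ∈ T, ∀ c, (t, c) ∉ F

theorem Sys.mono {F G : Set (V × V)} {r : V} (h : Sys G r) (hs : F ⊆ G) : Sys F r :=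
  ⟨fun a b c h1 h2 => h.inj a b c (hs h1) (hs h2),
   fun a b c h0 h1 h2 => h.out a b c h0 (hs h1) (hs h2), fun a h1 => h.nr a (hs h1)⟩

theorem Relation.ReflTransGen.upE {F G : Set (V × V)} {a b : V} (h : Rch F a b) (hs : F ⊆ G) :
    Rch G a b := Relation.ReflTransGen.mono (fun _ _ h => hs h) _ _ h

theorem rch_stuck {F : Set (V × V)} {x y : V} (h : Rch F x y) (hx : ∀ c, (x, c) ∉ F) : x = y := by
  induction h using Relation.ReflTransGen.head_induction_on with
  | refl => rfl
  | head h1 _ _ => exact absurd h1 (hx _)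

/-- forward uniqueness -/
theorem rch_unique {F : Set (V × V)} {r : V} (hF : Sys F r) {c s t : V} (hc : c ≠ r)
    (h1 : Rch F c s) (h2 : Rch F c t) (hs : ∀ d, (s, d) ∉ F) (ht : ∀ d, (t, d) ∉ F) : s = t := by
  induction h1 using Relation.ReflTransGen.head_induction_on with
  | refl => exact rch_stuck h2 hs
  | @head a b hab _ ih =>
    rcases Relation.ReflTransGen.cases_head h2 with rfl | ⟨d, had, hdt⟩
    · exact absurd hab (ht _)
    · obtain rfl := hF.out a b d hc hab had
      exact ih (fun h => hF.nr a (h ▸ hab)) hdt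

/-- reach `z` without using edges out of `z` -/
theorem rch_first {F : Set (V × V)} {a z : V} (h : Rch F a z) :
    Rch {e ∈ F | e.1 ≠ z} a z := by
  induction h using Relation.ReflTransGen.head_induction_on with
  | refl => exact .refl
  | @head a b hab _ ih =>
    by_cases haz : a = z
    · subst haz; exact .refl
    · exact Relation.ReflTransGen.head (show (a, b) ∈ {e ∈ F | e.1 ≠ z} from ⟨hab, haz⟩) ih

theorem rch_del {F : Set (V × V)} {x y a t : V} (h : Rch F a t) :
    Rch (F \ {(x, y)}) a t ∨ Rch (F \ {(x, y)}) y t := by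
  induction h using Relation.ReflTransGen.head_induction_on with
  | refl => exact Or.inl .refl
  | @head a b hab _ ih =>
    rcases ih with ih | ih
    · by_cases hh : (a, b) = (x, y)
      · obtain ⟨rfl, rfl⟩ := Prod.mk.inj hh
        exact Or.inr ih
      · exact Or.inl (Relation.ReflTransGen.head (show (a, b) ∈ F \ {(x, y)} from ⟨hab, hh⟩) ih)
    · exact Or.inr ih

theorem rch_tail_exists {F : Set (V × V)} {a t : V} (h : Rch F a t) (hne : t ≠ a) :
    ∃ z, Rch F a z ∧ (z, t) ∈ F := by
  rcases Relation.ReflTransGen.cases_tail h with rfl | ⟨c, h1, h2⟩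
  · exact absurd rfl hne
  · exact ⟨c, h1, h2⟩

/-- keep only edges on paths to `T` -/
def rest (F : Set (V × V)) (r : V) (T : Set V) : Set (V × V) :=
  {e ∈ F | Rch F r e.1 ∧ ∃ t ∈ T, Rch F e.2 t}

theorem rest_sub (F : Set (V × V)) (r : V) (T : Set V) : rest F r T ⊆ F := fun _ h => h.1

theorem rest_rch {F : Set (V × V)} {r : V} {T : Set V} {t x : V} (ht : t ∈ T) (h : Rch F r x)
    (hx : Rch F x t) : Rch (rest F r T) r x := by
  induction h with
  | refl => exact .refl
  | @tail b c h1 h2 ih =>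
    exact (ih (Relation.ReflTransGen.head h2 hx)).tail (show (b, c) ∈ rest F r T from ⟨h2, h1, t, ht, hx⟩)

theorem rest_clean {F : Set (V × V)} {r : V} {T : Set V} {a b : V} (h : (a, b) ∈ rest F r T) :
    Rch (rest F r T) r a := by
  obtain ⟨h1, h2, t, ht, h3⟩ := h
  exact rest_rch ht h2 (Relation.ReflTransGen.head h1 h3)

/-- a weaker cleaning is not needed: restricting to `T` preserves linkages. -/
theorem Lk.rest {E F : Set (V × V)} {r : V} {T T' : Set V} (h : Lk E r F T) (hT : T' ⊆ T) :
    Lk E r (rest F r T') T' :=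
  ⟨(rest_sub _ _ _).trans h.sub, h.sys.mono (rest_sub _ _ _),
    fun t ht => rest_rch ht (h.rch t (hT ht)) .refl,
    fun t ht c hc => h.noout t (hT ht) c hc.1⟩

/-- States of the augmentation process. -/
inductive St (E : Set (V × V)) (r : V) (F : Set (V × V)) : Set (V × V) → V → Prop
  | base : St E r F F r
  | ext {G x y} : St E r F G x → (x, y) ∈ E → y ≠ r → (∀ z, (z, y) ∉ G) → St E r F (insert (x, y) G) y
  | back {G x y z} : St E r F G x → (x, y) ∈ E → y ≠ x → (z, y) ∈ G → z ≠ r →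
      St E r F (insert (x, y) (G \ {(z, y)})) z
  | trunc {G x z} : St E r F G x → (z, x) ∈ G → z ≠ r → St E r F (G \ {(z, x)}) z

/-- Invariant of the augmentation process. -/
structure AInv (E : Set (V × V)) (r : V) (T : Set V) (G : Set (V × V)) (x : V) : Prop where
  lk : Lk E r G T
  rx : Rch G r x
  ox : x ≠ r → ∀ c, (x, c) ∉ G
  nx : x ∉ T
  cyc : ∀ a b, (a, b) ∈ G → Rch G r a ∨ Rch G b a

theorem AInv.tl {E : Set (V × V)} {r : V} {T : Set V} {G : Set (V × V)} {x : V}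
    (h : AInv E r T G x) : ∀ a b, (a, b) ∈ G → a ≠ r → ∃ z, (z, a) ∈ G := by
  intro a b hab ha
  rcases h.cyc a b hab with h1 | h1
  · obtain ⟨z, _, hz⟩ := rch_tail_exists h1 ha
    exact ⟨z, hz⟩
  · by_cases hba : a = b
    · exact ⟨a, by rw [← hba] at hab; exact hab⟩
    · obtain ⟨z, _, hz⟩ := rch_tail_exists h1 hba
      exact ⟨z, hz⟩

/-- comparability of forward reachable vertices -/
theorem rch_comp {F : Set (V × V)} {r : V} (hF : Sys F r) {c s t : V} (hc : c ≠ r)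
    (h1 : Rch F c s) (h2 : Rch F c t) (ht : ∀ d, (t, d) ∉ F) : Rch F s t := by
  induction h1 using Relation.ReflTransGen.head_induction_on with
  | refl => exact h2
  | @head a b hab _ ih =>
    rcases Relation.ReflTransGen.cases_head h2 with rfl | ⟨d, had, hdt⟩
    · exact absurd hab (ht _)
    · obtain rfl := hF.out a b d hc hab had
      exact ih (fun h => hF.nr a (h ▸ hab)) hdt

theorem St.inv {E : Set (V × V)} {r : V} {F : Set (V × V)} {T : Set V} (hr : r ∉ T)
    (hF : Lk E r F T) (hc : ∀ a b, (a, b) ∈ F → Rch F r a) {G : Set (V × V)} {x : V}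
    (h : St E r F G x) : AInv E r T G x := by
  induction h with
  | base =>
    refine ⟨hF, .refl, fun h => absurd rfl h, hr, fun a b hab => Or.inl (hc a b hab)⟩
  | @ext G x y _ hE hy hno ih =>
    have hyT : y ∉ T := fun hyT => by
      obtain ⟨z, _, hz⟩ := rch_tail_exists (ih.lk.rch y hyT) hy
      exact hno z hz
    have hyo : ∀ c, (y, c) ∉ G := fun c hyc => by
      obtain ⟨z, hz⟩ := ih.tl y c hyc hy
      exact hno z hz
    have hsub : G ⊆ insert (x, y) G := Set.subset_insert _ _
    have hxy : x ≠ y := by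
      rintro rfl
      obtain ⟨z, _, hz⟩ := rch_tail_exists ih.rx hy
      exact hno z hz
    have hrx := ih.rx.upE hsub
    refine ⟨⟨Set.insert_subset hE ih.lk.sub, ⟨?_, ?_, ?_⟩, fun t ht => (ih.lk.rch t ht).upE hsub, ?_⟩,
      hrx.tail (Set.mem_insert _ _), ?_, hyT, ?_⟩
    · rintro a b c (h1 | h1) (h2 | h2)
      · grind
      · grind
      · grind
      · exact ih.lk.sys.inj a b c h1 h2
    · rintro a b c ha (h1 | h1) (h2 | h2)
      · grind
      · obtain ⟨rfl, rfl⟩ := Prod.mk.inj h1; exact absurd h2 (ih.ox ha c)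
      · obtain ⟨rfl, rfl⟩ := Prod.mk.inj h2; exact absurd h1 (ih.ox ha b)
      · exact ih.lk.sys.out a b c ha h1 h2
    · rintro a (h1 | h1)
      · grind
      · exact ih.lk.sys.nr a h1
    · rintro t ht c (h1 | h1)
      · obtain ⟨rfl, rfl⟩ := Prod.mk.inj h1; exact ih.nx ht
      · exact ih.lk.noout t ht c h1
    · rintro _ c (h1 | h1)
      · grind
      · exact hyo c h1
    · rintro a b (h1 | h1)
      · obtain ⟨rfl, rfl⟩ := Prod.mk.inj h1
        exact Or.inl hrx
      · exact (ih.cyc a b h1).imp (fun h => h.upE hsub) (fun h => h.upE hsub)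
  | @back G x y z _ hE hyx hzy hzr ih =>
    have hyr : y ≠ r := fun h => ih.lk.sys.nr z (h ▸ hzy)
    have hzx : z ≠ x := by
      rintro rfl; exact ih.ox hzr y hzy
    have hsub : G \ {(z, y)} ⊆ insert (x, y) (G \ {(z, y)}) := Set.subset_insert _ _
    have hGs : Sys (G \ {(z, y)}) r := ih.lk.sys.mono Set.sdiff_subset
    have hzo : ∀ c, (z, c) ∉ G \ {(z, y)} := fun c hzc =>
      hzc.2 (by rw [ih.lk.sys.out z c y hzr hzc.1 hzy]; rfl)
    have hedge : (x, y) ∈ insert (x, y) (G \ {(z, y)}) := Set.mem_insert _ _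
    have hfst : ∀ c, Rch G c z → Rch (G \ {(z, y)}) c z := fun c h => by
      refine (rch_first h).upE ?_
      rintro ⟨a, b⟩ ⟨h1, h2⟩
      exact ⟨h1, fun h => h2 (congrArg Prod.fst h)⟩
    have hrx : Rch (insert (x, y) (G \ {(z, y)})) r x ∨ (x ≠ r ∧ Rch (G \ {(z, y)}) y x) := by
      rcases rch_del (x := z) (y := y) ih.rx with h' | h'
      · exact Or.inl (h'.upE hsub)
      · by_cases hxr : x = r
        · subst hxr; exact Or.inl .refl
        · exact Or.inr ⟨hxr, h'⟩
    have hrz : Rch (insert (x, y) (G \ {(z, y)})) r z := by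
      rcases ih.cyc z y hzy with h | h
      · exact (hfst r h).upE hsub
      · rcases hrx with h' | ⟨hxr, h'⟩
        · exact (h'.tail hedge).trans ((hfst y h).upE hsub)
        · exact absurd (rch_unique hGs hyr (hfst y h) h' hzo (fun d hd => ih.ox hxr d hd.1)) hzx
    have hall : ∀ t, t ∈ T → Rch (insert (x, y) (G \ {(z, y)})) r t := by
      intro t ht
      rcases rch_del (x := z) (y := y) (ih.lk.rch t ht) with h | h
      · exact h.upE hsub
      · rcases rch_del (x := z) (y := y) ih.rx with h' | h'
        · exact ((h'.upE hsub).tail (Set.mem_insert _ _)).trans (h.upE hsub)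
        · by_cases hxr : x = r
          · subst hxr
            exact Relation.ReflTransGen.head (Set.mem_insert _ _) (h.upE hsub)
          · have := rch_unique hGs hyr h h' (fun d hd => ih.lk.noout t ht d hd.1)
              (fun d hd => ih.ox hxr d hd.1)
            exact absurd (this ▸ ht) ih.nx
    refine ⟨⟨Set.insert_subset hE (Set.sdiff_subset.trans ih.lk.sub), ⟨?_, ?_, ?_⟩, hall, ?_⟩,
      hrz, ?_, ?_, ?_⟩
    · rintro a b c (h1 | h1) (h2 | h2)
      · grind
      · obtain ⟨rfl, rfl⟩ := Prod.mk.inj h1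
        exact absurd (by rw [ih.lk.sys.inj b z c h2.1 hzy]; rfl) h2.2
      · obtain ⟨rfl, rfl⟩ := Prod.mk.inj h2
        exact absurd (by rw [ih.lk.sys.inj a z c h1.1 hzy]; rfl) h1.2
      · exact hGs.inj a b c h1 h2
    · rintro a b c ha (h1 | h1) (h2 | h2)
      · grind
      · obtain ⟨rfl, rfl⟩ := Prod.mk.inj h1; exact absurd h2.1 (ih.ox ha c)
      · obtain ⟨rfl, rfl⟩ := Prod.mk.inj h2; exact absurd h1.1 (ih.ox ha b)
      · exact hGs.out a b c ha h1 h2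
    · rintro a (h1 | h1)
      · grind
      · exact hGs.nr a h1
    · rintro t ht c (h1 | h1)
      · obtain ⟨rfl, rfl⟩ := Prod.mk.inj h1; exact ih.nx ht
      · exact ih.lk.noout t ht c h1.1
    · rintro _ c (h1 | h1)
      · grind
      · exact hzo c h1
    · intro hzT; exact ih.lk.noout z hzT y hzy
    · rintro a b (h1 | h1)
      · obtain ⟨rfl, rfl⟩ := Prod.mk.inj h1
        rcases hrx with h' | ⟨_, h'⟩
        · exact Or.inl h'
        · exact Or.inr (h'.upE hsub)
      · have key : Rch (G \ {(z, y)}) y a → Rch (insert (x, y) (G \ {(z, y)})) r a ∨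
            Rch (insert (x, y) (G \ {(z, y)})) b a := by
          intro hya
          rcases hrx with h' | ⟨hxr, h'⟩
          · exact Or.inl ((h'.tail hedge).trans (hya.upE hsub))
          · right
            have hax := rch_comp hGs hyr hya h' (fun d hd => ih.ox hxr d hd.1)
            have har : a ≠ r := by
              rintro rfl
              obtain ⟨q, _, hq⟩ := rch_tail_exists hya (Ne.symm hyr)
              exact hGs.nr q hq
            rcases Relation.ReflTransGen.cases_head hax with rfl | ⟨d, had, hdx⟩
            · exact absurd h1.1 (ih.ox hxr b)
            · obtain rfl := hGs.out a b d har h1 had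
              exact ((hdx.upE hsub).tail hedge).trans (hya.upE hsub)
        rcases ih.cyc a b h1.1 with h | h
        · rcases rch_del (x := z) (y := y) h with h | h
          · exact Or.inl (h.upE hsub)
          · exact key h
        · rcases rch_del (x := z) (y := y) h with h | h
          · exact Or.inr (h.upE hsub)
          · exact key h
  | @trunc G x z _ hzx hzr ih =>
    have hxr : x ≠ r := fun h => ih.lk.sys.nr z (h ▸ hzx)
    have hGs : Sys (G \ {(z, x)}) r := ih.lk.sys.mono Set.sdiff_subset
    have hxo : ∀ c, (x, c) ∉ G \ {(z, x)} := fun c hc => ih.ox hxr c hc.1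
    have hzo : ∀ c, (z, c) ∉ G \ {(z, x)} := fun c hzc =>
      hzc.2 (by rw [ih.lk.sys.out z c x hzr hzc.1 hzx]; rfl)
    have hzx' : x ≠ z := by
      rintro rfl; exact ih.ox hxr _ hzx
    have hdel : ∀ a c, c ≠ x → Rch G a c → Rch (G \ {(z, x)}) a c := by
      intro a c hcx h
      rcases rch_del (x := z) (y := x) h with h | h
      · exact h
      · exact absurd (rch_stuck h hxo).symm hcx
    have hta : ∀ a b, (a, b) ∈ G → a ≠ x := by
      rintro a b hab rfl; exact ih.ox hxr _ hab
    refine ⟨⟨Set.sdiff_subset.trans ih.lk.sub, hGs, ?_, ?_⟩, ?_, fun _ => hzo, ?_, ?_⟩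
    · intro t ht
      exact hdel _ _ (by rintro rfl; exact ih.nx ht) (ih.lk.rch t ht)
    · intro t ht c hc
      exact ih.lk.noout t ht c hc.1
    · rcases ih.cyc z x hzx with h | h
      · exact hdel _ _ hzx'.symm h
      · exact absurd (rch_stuck h (ih.ox hxr)) hzx'
    · intro hzT; exact ih.lk.noout z hzT x hzx
    · intro a b hab
      exact (ih.cyc a b hab.1).imp (hdel _ _ (hta a b hab.1)) (hdel _ _ (hta a b hab.1))

/-- The augmentation lemma. -/
theorem augment {E : Set (V × V)} {r : V} {F : Set (V × V)} {T : Set V} {t₀ : V} (hr : r ∉ T)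
    (hF : Lk E r F T) (hc : ∀ a b, (a, b) ∈ F → Rch F r a) (ht₀ : t₀ ≠ r)
    (ht₀F : ∀ a, (a, t₀) ∉ F) :
    (∃ G, Lk E r G (insert t₀ T)) ∨
    ∃ K : Set V, r ∈ K ∧ (∀ t ∈ T, t ∉ K) ∧ t₀ ∉ K ∧
      (∀ x ∈ K, x ≠ r → ∃ z, (z, x) ∈ E) ∧
      ∀ a s, a ∈ K → s ∉ K → (a, s) ∈ E → Rch {e ∈ F | e.1 ∈ K} r s ∧ s ≠ t₀ := by
  by_cases hK : ∃ G, St E r F G t₀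
  · obtain ⟨G, hG⟩ := hK
    have hi := hG.inv hr hF hc
    left
    refine ⟨G, hi.lk.sub, hi.lk.sys, ?_, ?_⟩
    · rintro t (rfl | ht)
      · exact hi.rx
      · exact hi.lk.rch t ht
    · rintro t (rfl | ht)
      · exact hi.ox ht₀
      · exact hi.lk.noout t ht
  right
  set K : Set V := {x | ∃ G, St E r F G x} with hKdef
  have hrK : r ∈ K := ⟨F, .base⟩
  have c1 : ∀ G x, St E r F G x → ∀ y, (∃ z ∈ K, (z, y) ∈ G) → y ∈ K ∨ ∃ z ∈ K, (z, y) ∈ F := by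
    intro G x h
    induction h with
    | base => exact fun y h => Or.inr h
    | @ext G x y h hE hy hno ih =>
      rintro y' ⟨z, hz, h1 | h1⟩
      · obtain ⟨rfl, rfl⟩ := Prod.mk.inj h1
        exact Or.inl ⟨_, h.ext hE hy hno⟩
      · exact ih y' ⟨z, hz, h1⟩
    | @back G x y z h hE hyx hzy hzr ih =>
      rintro y' ⟨z', hz, h1 | h1⟩
      · obtain ⟨rfl, rfl⟩ := Prod.mk.inj h1
        exact ih _ ⟨z, ⟨_, h.back hE hyx hzy hzr⟩, hzy⟩
      · exact ih y' ⟨z', hz, h1.1⟩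
    | @trunc G x z h hzx hzr ih =>
      rintro y' ⟨z', hz, h1⟩
      exact ih y' ⟨z', hz, h1.1⟩
  have c2 : ∀ G x, St E r F G x → ∀ z y, (z, y) ∈ F → (z, y) ∈ G ∨ z ∈ K := by
    intro G x h
    induction h with
    | base => exact fun z y h => Or.inl h
    | @ext G x y h hE hy hno ih =>
      intro z' y' h1
      exact (ih z' y' h1).imp_left (fun h => Or.inr h)
    | @back G x y z h hE hyx hzy hzr ih =>
      intro z' y' h1
      rcases ih z' y' h1 with h2 | h2
      · by_cases hh : (z', y') = (z, y)
        · obtain ⟨rfl, rfl⟩ := Prod.mk.inj hh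
          exact Or.inr ⟨_, h.back hE hyx hzy hzr⟩
        · exact Or.inl (Or.inr ⟨h2, hh⟩)
      · exact Or.inr h2
    | @trunc G x z h hzx hzr ih =>
      intro z' y' h1
      rcases ih z' y' h1 with h2 | h2
      · by_cases hh : (z', y') = (z, x)
        · obtain ⟨rfl, rfl⟩ := Prod.mk.inj hh
          exact Or.inr ⟨_, h.trunc hzx hzr⟩
        · exact Or.inl ⟨h2, hh⟩
      · exact Or.inr h2
  have c3 : ∀ z y, (z, y) ∈ F → y ∈ K → z ∈ K := by
    rintro z y hzy ⟨G, hG⟩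
    by_cases hzr : z = r
    · rw [hzr]; exact hrK
    rcases c2 G y hG z y hzy with h | h
    · exact ⟨_, hG.trunc h hzr⟩
    · exact h
  have c4 : ∀ z, Rch F r z → z ∈ K → Rch {e ∈ F | e.1 ∈ K} r z := by
    intro z h
    induction h with
    | refl => exact fun _ => .refl
    | @tail b c _ h2 ih =>
      intro hcK
      have hb := c3 b c h2 hcK
      exact (ih hb).tail (show (b, c) ∈ {e ∈ F | e.1 ∈ K} from ⟨h2, hb⟩)
  refine ⟨K, hrK, ?_, hK, ?_, ?_⟩
  · rintro t ht ⟨G, hG⟩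
    exact (hG.inv hr hF hc).nx ht
  · rintro x ⟨G, hG⟩ hx
    have hi := hG.inv hr hF hc
    obtain ⟨z, _, hz⟩ := rch_tail_exists hi.rx hx
    exact ⟨z, hi.lk.sub hz⟩
  · rintro a s ⟨G, hG⟩ hs hE
    have hsr : s ≠ r := fun h => hs (h ▸ hrK)
    have h1 : ∃ z, (z, s) ∈ G := by
      by_contra hno
      push Not at hno
      exact hs ⟨_, hG.ext hE hsr hno⟩
    obtain ⟨z, hz⟩ := h1
    have hsa : s ≠ a := by
      rintro rfl; exact hs ⟨G, hG⟩
    have hzK : z ∈ K := by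
      by_cases hzr : z = r
      · rw [hzr]; exact hrK
      · exact ⟨_, hG.back hE hsa hz hzr⟩
    rcases c1 G a hG s ⟨z, hzK, hz⟩ with h | ⟨z', hz', h⟩
    · exact absurd h hs
    · refine ⟨(c4 z' (hc _ _ h) hz').tail (show (z', s) ∈ {e ∈ F | e.1 ∈ K} from ⟨h, hz'⟩), ?_⟩
      rintro rfl
      exact ht₀F _ h

/-- delete the vertex `w` -/
def delw (E : Set (V × V)) (w : V) : Set (V × V) := {e ∈ E | e.1 ≠ w ∧ e.2 ≠ w}

theorem cut_lemma {E : Set (V × V)} {r w u v : V} {B : Set V} {R : Set (V × V)} (hr : r ∉ B)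
    (hR : Lk (delw E w) r R B) (hno : ¬ ∃ G, Lk (delw E w \ {(u, v)}) r G B) (hu : u ≠ r)
    (hw : w ≠ r) :
    ∃ (K : Set V) (F : Set (V × V)), r ∈ K ∧ u ∈ K ∧ v ∉ K ∧ w ∉ K ∧ (∀ b ∈ B, b ∉ K) ∧
      F ⊆ rest R r B ∧ F ⊆ delw E w \ {(u, v)} ∧ (∀ e ∈ F, e.1 ∈ K) ∧ (∀ c, (u, c) ∉ F) ∧
      Rch F r u ∧ (∀ a s, a ∈ K → s ∉ K → (a, s) ∈ delw E w \ {(u, v)} → Rch F r s ∧ s ≠ v) ∧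
      (∀ a, (a, v) ∉ F) := by
  have hR0 := hR.rest (subset_refl B)
  set R0 := rest R r B with hR0def
  have h1 : ∃ b ∈ B, ¬ Rch (R0 \ {(u, v)}) r b := by
    by_contra hcon
    push Not at hcon
    exact hno ⟨R0 \ {(u, v)}, Set.sdiff_subset_sdiff_left hR0.sub, hR0.sys.mono Set.sdiff_subset, hcon,
      fun t ht c hc => hR0.noout t ht c hc.1⟩
  obtain ⟨b1, hb1, hnb⟩ := h1
  have hb1r : b1 ≠ r := fun h => hr (h ▸ hb1)
  have huvR : (u, v) ∈ R0 := by
    by_contra hcon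
    refine hnb ((hR0.rch b1 hb1).upE fun e he => ⟨he, ?_⟩)
    rintro rfl; exact hcon he
  have hvb : Rch (R0 \ {(u, v)}) v b1 := by
    rcases rch_del (x := u) (y := v) (hR0.rch b1 hb1) with h | h
    · exact absurd h hnb
    · exact h
  have hvb' : Rch R0 v b1 := hvb.upE Set.sdiff_subset
  have hR' := hR0.rest (T' := B \ {b1}) Set.sdiff_subset
  have hcl : ∀ a b, (a, b) ∈ rest R0 r (B \ {b1}) → Rch (rest R0 r (B \ {b1})) r a :=
    fun a b h => rest_clean h
  have hU : ∀ a c, (a, c) ∈ rest R0 r (B \ {b1}) → Rch R0 c b1 → False := by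
    rintro a c ⟨h1, h2, b, hb, h3⟩ h4
    have hcr : c ≠ r := fun h => hR0.sys.nr a (h ▸ h1)
    exact hb.2 (rch_unique hR0.sys hcr h3 h4 (hR0.noout b hb.1) (hR0.noout b1 hb1))
  set R' := rest R0 r (B \ {b1}) with hR'def
  have hR'R : R' ⊆ R0 := rest_sub _ _ _
  have hR'H : Lk (delw E w \ {(u, v)}) r R' (B \ {b1}) := by
    refine ⟨fun e he => ⟨hR'.sub he, ?_⟩, hR'.sys, hR'.rch, hR'.noout⟩
    rintro rfl
    exact hU _ _ he hvb'
  rcases augment (t₀ := b1) (fun h => hr h.1) hR'H hcl hb1r (fun a ha => hU a b1 ha .refl) with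
    ⟨G, hG⟩ | ⟨K, hrK, hBK, hbK, hin, hbd⟩
  · exfalso
    refine hno ⟨G, ?_⟩
    have : insert b1 (B \ {b1}) = B := by
      ext x; by_cases hx : x = b1 <;> simp [hx, hb1]
    rwa [this] at hG
  have hhead : ∀ s, s ∉ K → Rch {e ∈ R' | e.1 ∈ K} r s → Rch R0 s b1 → False := by
    intro s hs h h'
    have hsr : s ≠ r := fun h => hs (h ▸ hrK)
    obtain ⟨z, _, hz⟩ := rch_tail_exists h hsr
    exact hU z s hz.1 h'
  have hstay : ∀ a c, a ∈ K → (a, c) ∈ R0 → (a, c) ≠ (u, v) → Rch R0 c b1 → c ∈ K := by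
    intro a c ha hac hne hcb
    by_contra hcK
    exact hhead c hcK (hbd a c ha hcK ⟨hR0.sub hac, hne⟩).1 hcb
  have hvK : v ∉ K := by
    have : ∀ c, Rch (R0 \ {(u, v)}) c b1 → c ∈ K → False := by
      intro c h
      induction h using Relation.ReflTransGen.head_induction_on with
      | refl => exact hbK
      | @head a b hab h ih =>
        intro haK
        exact ih (hstay a b haK hab.1 hab.2 (h.upE Set.sdiff_subset))
    exact this v hvb
  have hub : Rch R0 u b1 := Relation.ReflTransGen.head huvR hvb'
  set F := {e ∈ R0 | e.1 ∈ K ∧ e ≠ (u, v)} with hFdef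
  have huK : ∀ x, Rch {e ∈ R0 | e.1 ≠ u} r x → Rch R0 x b1 → x ∈ K ∧ Rch F r x := by
    intro x h
    induction h with
    | refl => exact fun _ => ⟨hrK, .refl⟩
    | @tail b c _ h2 ih =>
      intro hcb
      obtain ⟨hb, hrb⟩ := ih (Relation.ReflTransGen.head h2.1 hcb)
      have hne : (b, c) ≠ (u, v) := fun h => h2.2 (congrArg Prod.fst h)
      exact ⟨hstay b c hb h2.1 hne hcb, hrb.tail (show (b, c) ∈ F from ⟨h2.1, hb, hne⟩)⟩
  have hru : Rch R0 r u := rest_clean huvR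
  obtain ⟨huK1, hFu⟩ := huK u (rch_first hru) hub
  refine ⟨K, F, hrK, huK1, hvK, ?_, ?_, fun e he => he.1, fun e he => ⟨hR0.sub he.1, he.2.2⟩,
    fun e he => he.2.1, ?_, hFu, ?_, ?_⟩
  · intro hwK
    obtain ⟨z, hz⟩ := hin w hwK hw
    exact hz.1.2.2 rfl
  · intro b hb hbK'
    by_cases hbb : b = b1
    · exact hbK (hbb ▸ hbK')
    · exact hBK b ⟨hb, hbb⟩ hbK'
  · intro c hc
    exact hc.2.2 (by rw [hR0.sys.out u c v hu hc.1 huvR])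
  · intro a s ha hs has
    have := hbd a s ha hs has
    refine ⟨this.1.upE ?_, ?_⟩
    · rintro e ⟨he1, he2⟩
      refine ⟨hR'R he1, he2, ?_⟩
      rintro rfl
      exact hU _ _ he1 hvb'
    · rintro rfl
      exact hhead s hs this.1 hvb'
  · intro a ha
    exact ha.2.2 (by rw [hR0.sys.inj a u v ha.1 huvR])

/-- The data from which the final path-system is read off. -/
structure Fine (E : Set (V × V)) (r u v : V) (M : Set V) (F : Set (V × V)) : Prop where
  rM : r ∈ M
  uM : u ∈ M
  vM : v ∉ M
  sub : F ⊆ E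
  sys : Sys F r
  tl : ∀ e ∈ F, e.1 ∈ M
  uv : (u, v) ∈ F
  lk : ∀ a s, a ∈ M → s ∉ M → (a, s) ∈ E → Rch F r s
  sep : ∀ x, (x, v) ∈ E → x ≠ u → x ∉ M

/-- Waves -/
structure Wv (E : Set (V × V)) (r v : V) (K : Set V) (F : Set (V × V)) : Prop where
  rK : r ∈ K
  vK : v ∉ K
  vb : ∀ a ∈ K, (a, v) ∉ E
  sub : F ⊆ E
  sys : Sys F r
  tl : ∀ e ∈ F, e.1 ∈ K
  lk : ∀ a s, a ∈ K → s ∉ K → (a, s) ∈ E → Rch F r s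

/-- out-neighbours of `K` -/
def bd (E : Set (V × V)) (K : Set V) : Set V := {c | ∃ a ∈ K, (a, c) ∈ E}

theorem case_one {E : Set (V × V)} {r w u v : V} {B : Set V} {R : Set (V × V)} (hr : r ∉ B)
    (hR : Lk (delw E w) r R B) (hno : ¬ ∃ G, Lk (delw E w \ {(u, v)}) r G B) (hu : u ≠ r)
    (hw : w ≠ r) (huv : (u, v) ∈ E) (hv : v ≠ w) {K : Set V} {F : Set (V × V)}
    (hW : Wv E r v K F)
    (hcase : w ∈ K ∨ w ∈ bd E K ∨ ∀ b, (b, w) ∈ E → b ∈ B) : ∃ M F, Fine E r u v M F := by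
  obtain ⟨K1, F1, hrK, huK, hvK, hwK, hBK, hF1R, hF1, hF1K, huF, hru, hbd, hvF⟩ :=
    cut_lemma hr hR hno hu hw
  have huKn : u ∉ K := fun h => hW.vb u h huv
  have hF1s : Sys F1 r := hR.sys.mono (hF1R.trans (rest_sub _ _ _))
  have hFh : ∀ a c, (a, c) ∈ F → c ∈ bd E K := fun a c h => ⟨a, hW.tl _ h, hW.sub h⟩
  have hvbd : v ∉ bd E K := by
    rintro ⟨a, ha, h⟩; exact hW.vb a ha h
  set F2 : Set (V × V) := F ∪ ({e ∈ F1 | e.1 ∉ K ∧ e.2 ∉ bd E K} ∪ {(u, v)}) with hF2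
  have hrch : ∀ s, s ∉ K → Rch F1 r s → Rch F2 r s := by
    intro s hs h
    induction h with
    | refl => exact absurd hW.rK hs
    | @tail b c _ h2 ih =>
      by_cases hc : c ∈ bd E K
      · obtain ⟨a, ha, hac⟩ := hc
        exact (hW.lk a c ha hs hac).upE Set.subset_union_left
      · have hb : b ∉ K := fun hb => hc ⟨b, hb, (hF1 h2).1.1⟩
        exact (ih hb).tail (show (b, c) ∈ F2 from Or.inr (Or.inl ⟨h2, hb, hc⟩))
  refine ⟨K ∪ K1, F2, Or.inl hW.rK, Or.inr huK, ?_, ?_, ⟨?_, ?_, ?_⟩, ?_, ?_, ?_, ?_⟩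
  · rintro (h | h)
    · exact hW.vK h
    · exact hvK h
  · rintro e (h | h | h)
    · exact hW.sub h
    · exact (hF1 h.1).1.1
    · rw [h]; exact huv
  · rintro a b c (h | h | h) (h' | h' | h')
    · exact hW.sys.inj a b c h h'
    · exact absurd (hFh _ _ h) h'.2.2
    · obtain ⟨rfl, rfl⟩ := Prod.mk.inj h'; exact absurd (hFh _ _ h) hvbd
    · exact absurd (hFh _ _ h') h.2.2
    · exact hF1s.inj a b c h.1 h'.1
    · obtain ⟨rfl, rfl⟩ := Prod.mk.inj h'; exact absurd h.1 (hvF _)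
    · obtain ⟨rfl, rfl⟩ := Prod.mk.inj h; exact absurd (hFh _ _ h') hvbd
    · obtain ⟨rfl, rfl⟩ := Prod.mk.inj h; exact absurd h'.1 (hvF _)
    · obtain ⟨rfl, rfl⟩ := Prod.mk.inj h; exact (Prod.mk.inj h').1.symm
  · rintro a b c ha (h | h | h) (h' | h' | h')
    · exact hW.sys.out a b c ha h h'
    · exact absurd (hW.tl _ h) h'.2.1
    · obtain ⟨rfl, rfl⟩ := Prod.mk.inj h'; exact absurd (hW.tl _ h) huKn
    · exact absurd (hW.tl _ h') h.2.1
    · exact hF1s.out a b c ha h.1 h'.1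
    · obtain ⟨rfl, rfl⟩ := Prod.mk.inj h'; exact absurd h.1 (huF _)
    · obtain ⟨rfl, rfl⟩ := Prod.mk.inj h; exact absurd (hW.tl _ h') huKn
    · obtain ⟨rfl, rfl⟩ := Prod.mk.inj h; exact absurd h'.1 (huF _)
    · obtain ⟨rfl, rfl⟩ := Prod.mk.inj h; exact (Prod.mk.inj h').2.symm
  · rintro a (h | h | h)
    · exact hW.sys.nr a h
    · exact hF1s.nr a h.1
    · have := (Prod.mk.inj h).2
      exact hvK (this ▸ hrK)
  · rintro e (h | h | h)
    · exact Or.inl (hW.tl _ h)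
    · exact Or.inr (hF1K _ h.1)
    · rw [h]; exact Or.inr huK
  · exact Or.inr (Or.inr rfl)
  · intro a s ha hs has
    have hsK : s ∉ K := fun h => hs (Or.inl h)
    have hsK1 : s ∉ K1 := fun h => hs (Or.inr h)
    by_cases haK : a ∈ K
    · exact (hW.lk a s haK hsK has).upE Set.subset_union_left
    have haK1 : a ∈ K1 := ha.resolve_left haK
    have haw : a ≠ w := by
      rintro rfl; exact hwK haK1
    by_cases hsw : s = w
    · subst hsw
      rcases hcase with h | h | h
      · exact absurd h hsK
      · obtain ⟨a', ha', h'⟩ := h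
        exact (hW.lk a' s ha' hsK h').upE Set.subset_union_left
      · exact absurd haK1 (hBK a (h a has))
    · by_cases he : (a, s) = (u, v)
      · obtain ⟨rfl, rfl⟩ := Prod.mk.inj he
        exact (hrch _ huKn hru).tail (Or.inr (Or.inr rfl))
      · exact hrch s hsK (hbd a s haK1 hsK1 ⟨⟨has, haw, hsw⟩, he⟩).1
  · rintro x hx hxu (h | h)
    · exact hW.vb x h hx
    · have hxw : x ≠ w := by
        rintro rfl; exact hwK h
      exact (hbd x v h hvK ⟨⟨hx, hxw, hv⟩, fun he => hxu (congrArg Prod.fst he)⟩).2 rfl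

/-- contraction of a wave -/
def con (E : Set (V × V)) (r : V) (K : Set V) : Set (V × V) :=
  {e | (e.1 = r ∧ e.2 ∈ bd E K ∧ e.2 ∉ K) ∨ (e ∈ E ∧ e.1 ∉ K ∧ e.2 ∉ K ∧ e.2 ∉ bd E K)}

theorem con_lift {E : Set (V × V)} {r v : V} {K : Set V} {F : Set (V × V)}
    (hW : Wv E r v K F) {G : Set (V × V)} (hG : G ⊆ con E r K) (hGs : Sys G r) :
    Sys (F ∪ {e ∈ G | e.1 ≠ r}) r ∧ (∀ s, Rch G r s → Rch (F ∪ {e ∈ G | e.1 ≠ r}) r s) ∧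
      (∀ e ∈ G, e.1 ≠ r → e ∈ E ∧ e.1 ∉ K ∧ e.2 ∉ K ∧ e.2 ∉ bd E K) := by
  have hFh : ∀ a c, (a, c) ∈ F → c ∈ bd E K := fun a c h => ⟨a, hW.tl _ h, hW.sub h⟩
  have h3 : ∀ e ∈ G, e.1 ≠ r → e ∈ E ∧ e.1 ∉ K ∧ e.2 ∉ K ∧ e.2 ∉ bd E K := by
    intro e he hr
    rcases hG he with h | h
    · exact absurd h.1 hr
    · exact h
  refine ⟨⟨?_, ?_, ?_⟩, ?_, h3⟩
  · rintro a b c (h | h) (h' | h')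
    · exact hW.sys.inj a b c h h'
    · exact absurd (hFh _ _ h) (h3 _ h'.1 h'.2).2.2.2
    · exact absurd (hFh _ _ h') (h3 _ h.1 h.2).2.2.2
    · exact hGs.inj a b c h.1 h'.1
  · rintro a b c ha (h | h) (h' | h')
    · exact hW.sys.out a b c ha h h'
    · exact absurd (hW.tl _ h) (h3 _ h'.1 h'.2).2.1
    · exact absurd (hW.tl _ h') (h3 _ h.1 h.2).2.1
    · exact hGs.out a b c ha h.1 h'.1
  · rintro a (h | h)
    · exact hW.sys.nr a h
    · exact hGs.nr a h.1
  · intro s h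
    induction h with
    | refl => exact .refl
    | @tail b c _ h2 ih =>
      by_cases hb : b = r
      · rcases hG h2 with h | h
        · obtain ⟨a, ha, hac⟩ := h.2.1
          exact (hW.lk a c ha h.2.2 hac).upE Set.subset_union_left
        · exact absurd hW.rK (hb ▸ h.2.1)
      · exact ih.tail (show (b, c) ∈ F ∪ {e ∈ G | e.1 ≠ r} from Or.inr ⟨h2, hb⟩)

/-- extending a wave -/
theorem wave_ext {E : Set (V × V)} {r v : V} {K : Set V} {F : Set (V × V)}
    (hW : Wv E r v K F) {K4 : Set V} {G : Set (V × V)} (hG : G ⊆ con E r K) (hGs : Sys G r)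
    (hr : r ∈ K4) (hv : v ∉ K4) (hvb : ∀ a ∈ K4, (a, v) ∉ con E r K) (htl : ∀ e ∈ G, e.1 ∈ K4)
    (hlk : ∀ a s, a ∈ K4 → s ∉ K4 → (a, s) ∈ con E r K → Rch G r s) :
    Wv E r v (K ∪ K4) (F ∪ {e ∈ G | e.1 ≠ r}) := by
  obtain ⟨h1, h2, h3⟩ := con_lift hW hG hGs
  have hout : ∀ a s, a ∈ K ∪ K4 → s ∉ K → (a, s) ∈ E → ∃ a' ∈ K4, (a', s) ∈ con E r K := by
    intro a s ha hsK has
    by_cases hsb : s ∈ bd E K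
    · exact ⟨r, hr, Or.inl ⟨rfl, hsb, hsK⟩⟩
    · have haK : a ∉ K := fun h => hsb ⟨a, h, has⟩
      exact ⟨a, ha.resolve_left haK, Or.inr ⟨has, haK, hsK, hsb⟩⟩
  refine ⟨Or.inl hW.rK, ?_, ?_, ?_, h1, ?_, ?_⟩
  · rintro (h | h)
    · exact hW.vK h
    · exact hv h
  · intro a ha hav
    obtain ⟨a', ha', h'⟩ := hout a v ha hW.vK hav
    exact hvb a' ha' h'
  · rintro e (h | h)
    · exact hW.sub h
    · exact (h3 e h.1 h.2).1
  · rintro e (h | h)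
    · exact Or.inl (hW.tl e h)
    · exact Or.inr (htl e h.1)
  · intro a s ha hs has
    obtain ⟨a', ha', h'⟩ := hout a s ha (fun h => hs (Or.inl h)) has
    exact h2 s (hlk a' s ha' (fun h => hs (Or.inr h)) h')

theorem case_two {E : Set (V × V)} {r w u v y : V} {B : Set V} {R : Set (V × V)} (hr : r ∉ B)
    (hyr : y ≠ r) (hyB : y ∉ B) (hBw : ∀ b ∈ B, (b, w) ∈ E) (hyw : (y, w) ∈ E)
    (hR : Lk (delw E w) r R (insert y B)) (hno : ¬ ∃ G, Lk (delw E w \ {(u, v)}) r G B)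
    (hu : u ≠ r) (hw : w ≠ r) (hv : v ≠ w) {K : Set V} {F : Set (V × V)}
    (hW : Wv E r v K F)
    (hmax : ∀ K' F', Wv E r v K' F' → K ⊆ K' → F ⊆ F' → K' ⊆ K)
    (hcase : ∀ K' F', Wv E r v K' F' → w ∉ K' ∧ w ∉ bd E K') : False := by
  obtain ⟨hwK, hwb⟩ := hcase K F hW
  have hNK : ∀ b, (b, w) ∈ E → b ∉ K := fun b hb h => hwb ⟨b, h, hb⟩
  have hBr : ∀ t ∈ insert y B, t ≠ r := by
    rintro t (rfl | ht)
    · exact hyr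
    · rintro rfl; exact hr ht
  have hBE : ∀ t ∈ insert y B, (t, w) ∈ E := by
    rintro t (rfl | ht)
    · exact hyw
    · exact hBw t ht
  -- the system in the contraction
  set Rs : Set (V × V) := {e | (e.1 = r ∧ e.2 ∈ bd E K ∧ e.2 ∉ K) ∨
    (e ∈ R ∧ e.1 ∉ K ∧ e.2 ∉ K ∧ e.2 ∉ bd E K)} with hRs
  have hRsrch : ∀ s, s ∉ K → Rch R r s → Rch Rs r s := by
    intro s hs h
    induction h with
    | refl => exact absurd hW.rK hs
    | @tail b c _ h2 ih =>
      by_cases hc : c ∈ bd E K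
      · exact Relation.ReflTransGen.single (show (r, c) ∈ Rs from Or.inl ⟨rfl, hc, hs⟩)
      · have hb : b ∉ K := fun hb => hc ⟨b, hb, (hR.sub h2).1⟩
        exact (ih hb).tail (show (b, c) ∈ Rs from Or.inr ⟨h2, hb, hs, hc⟩)
  have hRsL : Lk (delw (con E r K) w) r Rs (insert y B) := by
    refine ⟨?_, ⟨?_, ?_, ?_⟩, ?_, ?_⟩
    · rintro ⟨a, c⟩ (h | h)
      · refine ⟨Or.inl h, ?_, ?_⟩
        · exact fun h' => hw (h' ▸ h.1)
        · exact fun h' => hwb (h' ▸ h.2.1)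
      · exact ⟨Or.inr ⟨(hR.sub h.1).1, h.2⟩, (hR.sub h.1).2⟩
    · rintro a b c (h | h) (h' | h')
      · exact h.1.trans h'.1.symm
      · exact absurd h.2.1 h'.2.2.2
      · exact absurd h'.2.1 h.2.2.2
      · exact hR.sys.inj a b c h.1 h'.1
    · rintro a b c ha (h | h) (h' | h')
      · exact absurd h.1 ha
      · exact absurd h.1 ha
      · exact absurd h'.1 ha
      · exact hR.sys.out a b c ha h.1 h'.1
    · rintro a (h | h)
      · exact h.2.2 hW.rK
      · exact h.2.2.1 hW.rK
    · intro t ht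
      exact hRsrch t (hNK t (hBE t ht)) (hR.rch t ht)
    · rintro t ht c (h | h)
      · exact hBr t ht h.1
      · exact hR.noout t ht c h.1
  have hnos : ¬ ∃ G, Lk (delw (con E r K) w \ {(u, v)}) r G B := by
    rintro ⟨G, hG⟩
    have hGc : G ⊆ con E r K := fun e he => (hG.sub he).1.1
    obtain ⟨h1, h2, h3⟩ := con_lift hW hGc hG.sys
    refine hno ⟨_, ?_, h1, fun t ht => h2 t (hG.rch t ht), ?_⟩
    · rintro ⟨a, c⟩ (h | h)
      · refine ⟨⟨hW.sub h, ?_, ?_⟩, ?_⟩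
        · rintro rfl; exact hwK (hW.tl _ h)
        · rintro rfl; exact hwb ⟨a, hW.tl _ h, hW.sub h⟩
        · intro he
          obtain ⟨rfl, rfl⟩ := Prod.mk.inj he
          exact hW.vb _ (hW.tl _ h) (hW.sub h)
      · exact ⟨⟨(h3 _ h.1 h.2).1, (hG.sub h.1).1.2⟩, (hG.sub h.1).2⟩
    · rintro t ht c (h | h)
      · exact hNK t (hBw t ht) (hW.tl _ h)
      · exact hG.noout t ht c h.1
  have hRsB : Lk (delw (con E r K) w) r Rs B :=
    ⟨hRsL.sub, hRsL.sys, fun t ht => hRsL.rch t (Or.inr ht), fun t ht => hRsL.noout t (Or.inr ht)⟩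
  obtain ⟨K1, F1, hrK1, huK1, hvK1, hwK1, hBK1, hF1R, hF1, hF1K, huF, hru, hbd, hvF⟩ :=
    cut_lemma hr hRsB hnos hu hw
  have hF1s : Sys F1 r := hRsB.sys.mono (hF1R.trans (rest_sub _ _ _))
  have hF1c : F1 ⊆ con E r K := fun e he => (hF1 he).1.1
  -- the missed vertex
  obtain ⟨a, hra, hay⟩ : ∃ a, (r, a) ∈ Rs ∧ Rch Rs a y := by
    rcases Relation.ReflTransGen.cases_head (hRsL.rch y (Or.inl rfl)) with h | ⟨a, h1, h2⟩
    · exact absurd h.symm hyr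
    · exact ⟨a, h1, h2⟩
  have har : a ≠ r := fun h => hRsL.sys.nr r (h ▸ hra)
  have haF : ∀ z, (z, a) ∉ F1 := by
    intro z hz
    obtain ⟨_, _, b, hb, hab⟩ := hF1R hz
    have := rch_unique hRsL.sys har hay hab (hRsL.noout y (Or.inl rfl)) (hRsL.noout b (Or.inr hb))
    exact hyB (this ▸ hb)
  have haK : a ∉ K := by
    rcases hra with h | h
    · exact h.2.2
    · exact h.2.2.1
  have hrac : (r, a) ∈ con E r K := (hRsL.sub hra).1
  have hvu : v ≠ u := fun h => hvK1 (h ▸ huK1)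
  -- hindrances contradict maximality
  have hind : ∀ (K4 : Set V) (G : Set (V × V)), G ⊆ F1 → r ∈ K4 → v ∉ K4 → 
      (∀ e ∈ G, e.1 ∈ K4) → 
      (∀ a s, a ∈ K4 → s ∉ K4 → (a, s) ∈ con E r K → Rch G r s) → False := by
    intro K4 G hGF hr4 hv4 htl hlk
    have hh : ∀ x, x ≠ r → Rch G r x → ∃ z, (z, x) ∈ F1 := by
      intro x hx h
      obtain ⟨z, _, hz⟩ := rch_tail_exists h hx
      exact ⟨z, hGF hz⟩
    have hvr : v ≠ r := fun h => hvK1 (h ▸ hrK1)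
    have hwave := wave_ext hW (hGF.trans hF1c) (hF1s.mono hGF) hr4 hv4
      (fun x hx hxv => by
        obtain ⟨z, hz⟩ := hh v hvr (hlk x v hx hv4 hxv)
        exact hvF z hz) htl hlk
    have := hmax _ _ hwave Set.subset_union_left Set.subset_union_left
    by_cases ha4 : a ∈ K4
    · exact haK (this (Or.inr ha4))
    · obtain ⟨z, hz⟩ := hh a har (hlk r a hr4 ha4 hrac)
      exact haF z hz
  set T : Set V := insert u {s | s ∉ K1 ∧ ∃ x ∈ K1, (x, s) ∈ delw (con E r K) w \ {(u, v)}} with hT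
  set K2 : Set V := K1 \ {u} with hK2
  have hrK2 : r ∈ K2 := ⟨hrK1, fun h => hu h.symm⟩
  have hF1K2 : ∀ e ∈ F1, e.1 ∈ K2 := by
    rintro ⟨x, z⟩ he
    refine ⟨hF1K _ he, ?_⟩
    rintro rfl
    exact huF _ he
  have hTrch : ∀ t ∈ T, Rch F1 r t := by
    rintro t (rfl | ⟨ht, x, hx, hxt⟩)
    · exact hru
    · exact (hbd x t hx ht hxt).1
  have hK2bd : ∀ x s, x ∈ K2 → s ∉ K2 → (x, s) ∈ con E r K → s = w ∨ s ∈ T := by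
    intro x s hx hs hxs
    by_cases hsw : s = w
    · exact Or.inl hsw
    right
    by_cases hsu : s = u
    · exact Or.inl hsu
    · refine Or.inr ⟨fun h => hs ⟨h, hsu⟩, x, hx.1, ⟨hxs, ?_, hsw⟩, ?_⟩
      · rintro rfl; exact hwK1 hx.1
      · intro h; exact hx.2 (congrArg Prod.fst h)
  have hvT : v ∉ T := by
    rintro (h | ⟨_, x, hx, hxv⟩)
    · exact hvu h
    · exact (hbd x v hx hvK1 hxv).2 rfl
  by_cases hN : ∃ b ∈ K2, (b, w) ∈ con E r K
  swap
  · refine hind K2 F1 (subset_refl _) hrK2 (fun h => hvK1 h.1) hF1K2 ?_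
    intro x s hx hs hxs
    rcases hK2bd x s hx hs hxs with rfl | h
    · exact absurd ⟨x, hx, hxs⟩ hN
    · exact hTrch s h
  obtain ⟨b, hbK2, hbw⟩ := hN
  have hTK2 : ∀ t ∈ T, t ∉ K2 := by
    rintro t (rfl | ⟨ht, _⟩) h
    · exact h.2 rfl
    · exact ht h.1
  have hF1T : Lk (con E r K) r F1 T :=
    ⟨hF1c, hF1s, hTrch, fun t ht c hc => hTK2 t ht (hF1K2 _ hc)⟩
  have hFT := hF1T.rest (subset_refl T)
  rcases augment (t₀ := w) (fun h => hTK2 r h hrK2) hFT (fun a b h => rest_clean h) hw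
    (fun x hx => (hF1 (rest_sub _ _ _ hx)).1.2.2 rfl) with
    ⟨G, hG⟩ | ⟨K3, hrK3, hTK3, hwK3, -, hbd3⟩
  · have hst : ∀ x, Rch G r x → (x ∈ K2 ∨ x ∈ insert w T) ∧ Rch {e ∈ G | e.1 ∈ K2} r x := by
      intro x h
      induction h with
      | refl => exact ⟨Or.inl hrK2, .refl⟩
      | @tail c d _ h2 ih =>
        have hc : c ∈ K2 := ih.1.resolve_right fun h => hG.noout c h d h2
        refine ⟨?_, ih.2.tail (show (c, d) ∈ {e ∈ G | e.1 ∈ K2} from ⟨h2, hc⟩)⟩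
        by_cases hd : d ∈ K2
        · exact Or.inl hd
        · exact Or.inr (hK2bd c d hc hd (hG.sub h2))
    have hwave := wave_ext hW (K4 := K2) (G := {e ∈ G | e.1 ∈ K2}) (fun e he => hG.sub he.1)
      (hG.sys.mono fun e he => he.1) hrK2 (fun h => hvK1 h.1)
      (fun x hx hxv => by
        rcases hK2bd x v hx (fun h => hvK1 h.1) hxv with h | h
        · exact hv h
        · exact hvT h) (fun e he => he.2)
      (fun x s hx hs hxs => (hst s (hG.rch s (hK2bd x s hx hs hxs))).2)
    refine (hcase _ _ hwave).2 ⟨b, Or.inr hbK2, ?_⟩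
    rcases hbw with h | h
    · exact absurd h.2.1 hwb
    · exact h.1
  · refine hind (K3 ∩ K2) {e ∈ rest F1 r T | e.1 ∈ K3} (fun e he => rest_sub _ _ _ he.1)
      ⟨hrK3, hrK2⟩ (fun h => hvK1 h.2.1) (fun e he => ⟨he.2, hF1K2 e (rest_sub _ _ _ he.1)⟩) ?_
    intro x s hx hs hxs
    by_cases hs3 : s ∈ K3
    · exfalso
      rcases hK2bd x s hx.2 (fun h => hs ⟨hs3, h⟩) hxs with rfl | h
      · exact hwK3 hs3
      · exact hTK3 s h hs3
    · exact (hbd3 x s hx.1 hs3 hxs).1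

theorem wv_triv {E : Set (V × V)} {r v : V} (hvr : v ≠ r) (hrv : (r, v) ∉ E) :
    Wv E r v {r} {e ∈ E | e.1 = r ∧ e.2 ≠ r} := by
  refine ⟨rfl, hvr, ?_, fun e he => he.1, ⟨?_, ?_, ?_⟩, fun e he => he.2.1, ?_⟩
  · rintro a rfl; exact hrv
  · intro a b c h1 h2; exact h1.2.1.trans h2.2.1.symm
  · intro a b c h0 h1; exact absurd h1.2.1 h0
  · intro a h; exact h.2.2 rfl
  · rintro a s rfl hs h
    exact Relation.ReflTransGen.single ⟨h, rfl, hs⟩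

theorem wv_max {E : Set (V × V)} {r v : V} {K₀ : Set V} {F₀ : Set (V × V)}
    (h₀ : Wv E r v K₀ F₀) :
    ∃ K F, Wv E r v K F ∧ ∀ K' F', Wv E r v K' F' → K ⊆ K' → F ⊆ F' → K' ⊆ K := by
  obtain ⟨m, -, hm⟩ := zorn_le_nonempty₀
    {p : Set V × Set (V × V) | Wv E r v p.1 p.2} (by
      intro c hc hch y hy
      have hdir : ∀ p ∈ c, ∀ q ∈ c, ∃ z ∈ c, p ≤ z ∧ q ≤ z := by
        intro p hp q hq
        rcases hch.total hp hq with h | h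
        · exact ⟨q, hq, h, le_rfl⟩
        · exact ⟨p, hp, le_rfl, h⟩
      refine ⟨({a | ∃ p ∈ c, a ∈ p.1}, {e | ∃ p ∈ c, e ∈ p.2}), ?_, ?_⟩
      · refine ⟨⟨y, hy, (hc hy).rK⟩, ?_, ?_, ?_, ⟨?_, ?_, ?_⟩, ?_, ?_⟩
        · rintro ⟨p, hp, h⟩; exact (hc hp).vK h
        · rintro a ⟨p, hp, h⟩; exact (hc hp).vb a h
        · rintro e ⟨p, hp, h⟩; exact (hc hp).sub h
        · rintro a b d ⟨p, hp, h⟩ ⟨q, hq, h'⟩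
          obtain ⟨z, hz, h1, h2⟩ := hdir p hp q hq
          exact (hc hz).sys.inj a b d (h1.2 h) (h2.2 h')
        · rintro a b d h0 ⟨p, hp, h⟩ ⟨q, hq, h'⟩
          obtain ⟨z, hz, h1, h2⟩ := hdir p hp q hq
          exact (hc hz).sys.out a b d h0 (h1.2 h) (h2.2 h')
        · rintro a ⟨p, hp, h⟩; exact (hc hp).sys.nr a h
        · rintro e ⟨p, hp, h⟩; exact ⟨p, hp, (hc hp).tl e h⟩
        · rintro a s ⟨p, hp, h⟩ hs he
          have := (hc hp).lk a s h (fun hh => hs ⟨p, hp, hh⟩) he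
          exact this.upE (fun e he => ⟨p, hp, he⟩)
      · intro z hz
        exact ⟨fun a ha => ⟨z, hz, ha⟩, fun a ha => ⟨z, hz, ha⟩⟩) (K₀, F₀) h₀
  refine ⟨m.1, m.2, hm.prop, ?_⟩
  intro K' F' h1 h2 h3
  have := hm.le_of_ge (y := (K', F')) h1 ⟨h2, h3⟩
  exact this.1

theorem graph_main {E : Set (V × V)} {r w u v : V} {B : Set V} {R : Set (V × V)} (hr : r ∉ B)
    (hR : Lk (delw E w) r R B) (hno : ¬ ∃ G, Lk (delw E w \ {(u, v)}) r G B) (hu : u ≠ r)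
    (hw : w ≠ r) (huv : (u, v) ∈ E) (hv : v ≠ w) (hrw : (r, w) ∉ E)
    (hBw : ∀ b ∈ B, (b, w) ∈ E)
    (hext : ∀ y, (y, w) ∈ E → y ∉ B → ∃ Ry, Lk (delw E w) r Ry (insert y B)) :
    ∃ M F, Fine E r u v M F := by
  have huvR : (u, v) ∈ R := by
    by_contra h
    exact hno ⟨R, fun e he => ⟨hR.sub he, fun h1 => h (by rw [← (h1 : e = (u, v))]; exact he)⟩,
      hR.sys, hR.rch, hR.noout⟩
  have hvr : v ≠ r := by rintro rfl; exact hR.sys.nr _ huvR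
  have hrv : (r, v) ∉ E := by
    intro hrv
    refine hno ⟨insert (r, v) (R \ {(u, v)}), ?_, ⟨?_, ?_, ?_⟩, ?_, ?_⟩
    · rintro e (rfl | he)
      · exact ⟨⟨hrv, hw.symm, hv⟩, fun h => hu (Prod.mk.inj h).1.symm⟩
      · exact ⟨hR.sub he.1, he.2⟩
    · rintro a b c (h | h) (h' | h')
      · exact (Prod.mk.inj h).1.trans (Prod.mk.inj h').1.symm
      · obtain ⟨rfl, rfl⟩ := Prod.mk.inj h
        obtain rfl := hR.sys.inj _ _ _ h'.1 huvR
        exact absurd rfl h'.2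
      · obtain ⟨rfl, rfl⟩ := Prod.mk.inj h'
        obtain rfl := hR.sys.inj _ _ _ h.1 huvR
        exact absurd rfl h.2
      · exact hR.sys.inj _ _ _ h.1 h'.1
    · rintro a b c h0 (h | h) (h' | h')
      · exact absurd (Prod.mk.inj h).1 h0
      · exact absurd (Prod.mk.inj h).1 h0
      · exact absurd (Prod.mk.inj h').1 h0
      · exact hR.sys.out _ _ _ h0 h.1 h'.1
    · rintro a (h | h)
      · exact hvr (Prod.mk.inj h).2.symm
      · exact hR.sys.nr _ h.1
    · intro t ht
      rcases rch_del (x := u) (y := v) (hR.rch t ht) with h | h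
      · exact h.upE (Set.subset_insert _ _)
      · exact Relation.ReflTransGen.head (Set.mem_insert _ _) (h.upE (Set.subset_insert _ _))
    · rintro t ht c (h | h)
      · obtain ⟨rfl, rfl⟩ := Prod.mk.inj h
        exact hr ht
      · exact hR.noout t ht c h.1
  have hT := wv_triv hvr hrv
  by_cases hN : ∀ b, (b, w) ∈ E → b ∈ B
  · exact case_one hr hR hno hu hw huv hv hT (Or.inr (Or.inr hN))
  by_cases hc : ∀ K' F', Wv E r v K' F' → w ∉ K' ∧ w ∉ bd E K'
  · push Not at hN
    obtain ⟨y, hyw, hyB⟩ := hN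
    obtain ⟨Ry, hRy⟩ := hext y hyw hyB
    obtain ⟨K, F, hW, hmax⟩ := wv_max hT
    have hyr : y ≠ r := by rintro rfl; exact hrw hyw
    exact (case_two hr hyr hyB hBw hyw hRy hno hu hw hv hW hmax hc).elim
  · push Not at hc
    obtain ⟨K, F, hW, h⟩ := hc
    refine case_one hr hR hno hu hw huv hv hW ?_
    by_cases hK : w ∈ K
    · exact Or.inl hK
    · exact Or.inr (Or.inl (h hK))

/-- list of edges of a vertex list -/
def eds (a : V) (l : List V) : List (V × V) := (a :: l).zip l

theorem eds_cons (a b : V) (l : List V) : eds a (b :: l) = (a, b) :: eds b l := rfl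

theorem eds_fst {a x y : V} {l : List V} (h : (x, y) ∈ eds a l) : x ∈ a :: l :=
  (List.of_mem_zip h).1

theorem eds_snd {a x y : V} {l : List V} (h : (x, y) ∈ eds a l) : y ∈ l :=
  (List.of_mem_zip h).2

theorem eds_mem {F : Set (V × V)} {a x y : V} {l : List V}
    (hc : List.IsChain (fun a b => (a, b) ∈ F) (a :: l)) (h : (x, y) ∈ eds a l) :
    (x, y) ∈ F := by
  induction l generalizing a with
  | nil => simp [eds] at h
  | cons b l ih =>
    rw [List.isChain_cons_cons] at hc
    rw [eds_cons, List.mem_cons] at h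
    rcases h with h | h
    · rw [h]; exact hc.1
    · exact ih hc.2 h

theorem eds_inj {a x y z : V} {l : List V} (hn : (a :: l).Nodup) (h1 : (x, z) ∈ eds a l)
    (h2 : (y, z) ∈ eds a l) : x = y := by
  induction l generalizing a with
  | nil => simp [eds] at h1
  | cons b l ih =>
    rw [List.nodup_cons] at hn
    have hb := (List.nodup_cons.1 hn.2).1
    rw [eds_cons, List.mem_cons] at h1 h2
    rcases h1 with h1 | h1 <;> rcases h2 with h2 | h2
    · exact (Prod.mk.inj h1).1.trans (Prod.mk.inj h2).1.symm
    · rw [(Prod.mk.inj h1).2] at h2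
      exact absurd (eds_snd h2) hb
    · rw [(Prod.mk.inj h2).2] at h1
      exact absurd (eds_snd h1) hb
    · exact ih hn.2 h1 h2

theorem eds_out {a x y z : V} {l : List V} (hn : (a :: l).Nodup) (h1 : (z, x) ∈ eds a l)
    (h2 : (z, y) ∈ eds a l) : x = y := by
  induction l generalizing a with
  | nil => simp [eds] at h1
  | cons b l ih =>
    rw [List.nodup_cons] at hn
    rw [eds_cons, List.mem_cons] at h1 h2
    rcases h1 with h1 | h1 <;> rcases h2 with h2 | h2
    · exact (Prod.mk.inj h1).2.trans (Prod.mk.inj h2).2.symm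
    · rw [(Prod.mk.inj h1).1] at h2
      exact absurd (eds_fst h2) hn.1
    · rw [(Prod.mk.inj h2).1] at h1
      exact absurd (eds_fst h1) hn.1
    · exact ih hn.2 h1 h2

theorem eds_last {a x y : V} {l : List V} (hn : (a :: l).Nodup) (h : (x, y) ∈ eds a l) :
    x ≠ (a :: l).getLast (List.cons_ne_nil _ _) := by
  induction l generalizing a with
  | nil => simp [eds] at h
  | cons b l ih =>
    rw [List.getLast_cons (List.cons_ne_nil _ _)]
    rw [List.nodup_cons] at hn
    rw [eds_cons, List.mem_cons] at h
    rcases h with h | h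
    · rw [(Prod.mk.inj h).1]
      intro h'
      exact hn.1 (h' ▸ List.getLast_mem _)
    · exact ih hn.2 h

theorem eds_append (a w : V) (l : List V) :
    (eds a (l ++ [w])).getLast? = some ((a :: l).getLast (List.cons_ne_nil _ _), w) := by
  induction l generalizing a with
  | nil => rfl
  | cons b l ih =>
    rw [List.cons_append, eds_cons, List.getLast_cons (List.cons_ne_nil _ _), ← ih b]
    rw [List.getLast?_cons, ih b]; rfl

theorem rch_eds (a : V) (l : List V) {x : V} (hx : x ∈ a :: l) :
    Rch {e | e ∈ eds a l} a x := by
  induction l generalizing a with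
  | nil => obtain rfl := List.mem_singleton.1 hx; exact .refl
  | cons b l ih =>
    rcases List.mem_cons.1 hx with rfl | hx
    · exact .refl
    · exact Relation.ReflTransGen.head (b := b) (List.mem_cons_self)
        ((ih b hx).upE (fun e he => List.mem_cons_of_mem _ he))

theorem eds_append_mem {a w : V} {l : List V} {e : V × V} (h : e ∈ eds a l) :
    e ∈ eds a (l ++ [w]) := by
  induction l generalizing a with
  | nil => simp [eds] at h
  | cons b l ih =>
    rw [List.cons_append, eds_cons, List.mem_cons]
    rw [eds_cons, List.mem_cons] at h
    exact h.imp id (fun h => ih h)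

theorem rch_to_last {F : Set (V × V)} {a x : V} {l : List V}
    (hc : List.IsChain (fun a b => (a, b) ∈ F) (a :: l)) (h : x ∈ a :: l) :
    Rch F x ((a :: l).getLast (List.cons_ne_nil _ _)) := by
  induction l generalizing a x with
  | nil => obtain rfl := List.mem_singleton.1 h; exact .refl
  | cons b l ih =>
    rw [List.isChain_cons_cons] at hc
    rw [List.getLast_cons (List.cons_ne_nil _ _)]
    rcases List.mem_cons.1 h with rfl | h
    · exact Relation.ReflTransGen.head hc.1 (ih hc.2 List.mem_cons_self)
    · exact ih hc.2 h

theorem chain_in {F : Set (V × V)} {a x : V} {l : List V}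
    (hc : List.IsChain (fun a b => (a, b) ∈ F) (a :: l)) (h : x ∈ l) : ∃ z, (z, x) ∈ F := by
  induction l generalizing a with
  | nil => simp at h
  | cons b l ih =>
    rw [List.isChain_cons_cons] at hc
    rcases List.mem_cons.1 h with rfl | h
    · exact ⟨a, hc.1⟩
    · exact ih hc.2 h

theorem chain_out {F : Set (V × V)} {a x : V} {l : List V}
    (hc : List.IsChain (fun a b => (a, b) ∈ F) (a :: l)) (h : x ∈ l.dropLast) :
    ∃ z, (x, z) ∈ F := by
  induction l generalizing a with
  | nil => simp at h
  | cons b l ih =>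
    rw [List.isChain_cons_cons] at hc
    cases l with
    | nil => simp at h
    | cons c l =>
      rw [List.dropLast_cons_cons] at h
      rcases List.mem_cons.1 h with rfl | h
      · exact ⟨c, (List.isChain_cons_cons.1 hc.2).1⟩
      · exact ih hc.2 h

theorem rch_path {F : Set (V × V)} {a t : V} (h : Rch F a t) :
    ∃ l, List.IsChain (fun a b => (a, b) ∈ F) (a :: l) ∧ (a :: l).Nodup ∧
      (a :: l).getLast (List.cons_ne_nil _ _) = t := by
  induction h using Relation.ReflTransGen.head_induction_on with
  | refl => exact ⟨[], by simp, by simp, rfl⟩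
  | @head a b hab _ ih =>
    obtain ⟨l, hc, hn, hl⟩ := ih
    by_cases ha : a ∈ b :: l
    · obtain ⟨s, l', hs⟩ := List.append_of_mem ha
      have hsuf : (a :: l') <:+ (b :: l) := ⟨s, hs.symm⟩
      refine ⟨l', hc.suffix hsuf, hn.sublist hsuf.sublist, ?_⟩
      rw [← hl]; simp [hs]
    · refine ⟨b :: l, List.isChain_cons_cons.2 ⟨hab, hc⟩, List.nodup_cons.2 ⟨ha, hn⟩, ?_⟩
      rw [List.getLast_cons (List.cons_ne_nil _ _), hl]

theorem Dipath.isChain {E : Set (V × V)} (p : Dipath E) :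
    List.IsChain (fun a b => (a, b) ∈ E) (p.start :: p.rest) := p.chain

/-- structure of the last edge -/
theorem Dipath.lastEdge_spec {E : Set (V × V)} (p : Dipath E) {x y : V}
    (h : p.lastEdge? = some (x, y)) : p.last = y ∧ (x, y) ∈ p.edges ∧
      ∃ l, p.rest = l ++ [y] ∧ (p.start :: l).getLast (List.cons_ne_nil _ _) = x := by
  refine ⟨?_, List.mem_of_getLast? h, ?_⟩ <;>
  · rcases List.eq_nil_or_concat p.rest with h0 | ⟨l, z, h0⟩
    · simp [Dipath.lastEdge?, Dipath.edges, h0] at h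
    · rw [List.concat_eq_append] at h0
      have h1 := eds_append p.start z l
      have h2 : (eds p.start p.rest).getLast? = some (x, y) := h
      rw [h0, h1] at h2
      obtain ⟨h3, h4⟩ := Prod.mk.inj (Option.some.inj h2)
      first
      | exact ⟨l, by rw [h0, h4], h3⟩
      | simp [Dipath.last, h0, h4]

theorem gset_lk {E : Set (V × V)} {r w : V} (hw : w ≠ r) (hrw : (r, w) ∉ E) {I : Set (V × V)}
    (hI : I ∈ GSet E r w) :
    I ⊆ inEdges E w ∧ ∃ F, Lk (delw E w) r F {b | (b, w) ∈ I} := by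
  obtain ⟨P, ⟨hP1, hP2⟩, rfl⟩ := hI
  have hsub : termEdges P ⊆ inEdges E w := by
    rintro ⟨x, y⟩ ⟨p, hp, h⟩
    obtain ⟨h1, h2, -⟩ := p.lastEdge_spec h
    exact ⟨eds_mem p.isChain h2, h1.symm.trans (hP1 p hp).2⟩
  have heq : ∀ p ∈ P, ∀ q ∈ P, ∀ x, x ∈ p.verts → x ∈ q.verts → x ≠ r → x ≠ w → p = q := by
    intro p hp q hq x h1 h2 h3 h4
    by_contra hne
    rcases hP2 hp hq hne ⟨h1, h2⟩ with h | h
    · exact h3 h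
    · exact h4 h
  have hsr : ∀ p ∈ P, ∀ a b, (a, b) ∈ p.edges → b ≠ r := by
    intro p hp a b h hb
    have := (List.nodup_cons.1 p.nodup).1
    rw [(hP1 p hp).1, ← hb] at this
    exact this (eds_snd h)
  have hsw : ∀ p ∈ P, ∀ a b, (a, b) ∈ p.edges → a ≠ w := by
    intro p hp a b h ha
    exact eds_last p.nodup h (ha.trans (hP1 p hp).2.symm)
  have hv1 : ∀ p : Dipath E, ∀ a b, (a, b) ∈ p.edges → a ∈ p.verts := fun p a b h => eds_fst h
  have hv2 : ∀ p : Dipath E, ∀ a b, (a, b) ∈ p.edges → b ∈ p.verts :=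
    fun p a b h => List.mem_cons_of_mem _ (eds_snd h)
  refine ⟨hsub, {e | ∃ p ∈ P, e ∈ p.edges ∧ e.2 ≠ w}, ?_, ⟨?_, ?_, ?_⟩, ?_, ?_⟩
  · rintro ⟨x, y⟩ ⟨p, hp, h, h'⟩
    exact ⟨eds_mem p.isChain h, hsw p hp x y h, h'⟩
  · rintro a b c ⟨p, hp, h, h'⟩ ⟨q, hq, k, k'⟩
    obtain rfl := heq p hp q hq c (hv2 _ _ _ h) (hv2 _ _ _ k) (hsr p hp _ _ h) h'
    exact eds_inj p.nodup h k
  · rintro a b c h0 ⟨p, hp, h, h'⟩ ⟨q, hq, k, k'⟩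
    obtain rfl := heq p hp q hq a (hv1 _ _ _ h) (hv1 _ _ _ k) h0 (hsw p hp _ _ h)
    exact eds_out p.nodup h k
  · rintro a ⟨p, hp, h, h'⟩
    exact hsr p hp _ _ h rfl
  · rintro t ⟨p, hp, h⟩
    obtain ⟨h1, h2, l, h3, h4⟩ := p.lastEdge_spec h
    have h5 := rch_eds p.start l (x := t) (h4 ▸ List.getLast_mem _)
    rw [(hP1 p hp).1] at h5
    refine h5.upE ?_
    rintro ⟨x, y⟩ he
    refine ⟨p, hp, ?_, ?_⟩
    · show (x, y) ∈ eds p.start p.rest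
      rw [h3, (hP1 p hp).1]; exact eds_append_mem he
    · rintro rfl
      have hn := (List.nodup_cons.1 p.nodup).2
      rw [h3] at hn
      exact (List.disjoint_of_nodup_append hn) (eds_snd he) (List.mem_singleton.2 rfl)
  · rintro t ht c ⟨q, hq, k, k'⟩
    have htE := hsub ht
    obtain ⟨p, hp, h⟩ := ht
    obtain ⟨h1, h2, -⟩ := p.lastEdge_spec h
    have htr : t ≠ r := by rintro rfl; exact hrw htE.1
    obtain rfl := heq p hp q hq t (hv1 _ _ _ h2) (hv1 _ _ _ k) htr (hsw p hp _ _ h2)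
    exact k' (eds_out p.nodup k h2)

theorem lk_gset {E : Set (V × V)} {r w u v : V} (hw : w ≠ r) (hv : v ≠ w) {I : Set (V × V)}
    (hI : I ⊆ inEdges E w) {G : Set (V × V)}
    (hG : Lk (delw E w \ {(u, v)}) r G {b | (b, w) ∈ I}) : I ∈ GSet (E \ {(u, v)}) r w := by
  have hIm : ∀ e ∈ I, e = (e.1, w) := fun e he => Prod.ext rfl (hI he).2
  have hex : ∀ b : {b | (b, w) ∈ I}, ∃ p : Dipath (E \ {(u, v)}), p.start = r ∧ p.last = w ∧
      p.lastEdge? = some (b.1, w) ∧ ∀ x ∈ p.verts, x = w ∨ Rch G x b.1 := by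
    rintro ⟨b, hb⟩
    obtain ⟨l, hc, hn, hl⟩ := rch_path (hG.rch b hb)
    have hwl : w ∉ r :: l := by
      intro h
      rcases List.mem_cons.1 h with h | h
      · exact hw h
      · obtain ⟨z, hz⟩ := chain_in hc h
        exact (hG.sub hz).1.2.2 rfl
    refine ⟨⟨r, l ++ [w], ?_, ?_⟩, rfl, ?_, ?_, ?_⟩
    · show List.IsChain _ ((r :: l) ++ [w])
      rw [List.isChain_append]
      refine ⟨hc.imp (fun a b h => ⟨(hG.sub h).1.1, (hG.sub h).2⟩), by simp, ?_⟩
      intro x hx y hy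
      rw [List.getLast?_eq_some_getLast (List.cons_ne_nil _ _), hl] at hx
      simp at hx hy
      subst hx; subst hy
      exact ⟨(hI hb).1, fun h => hv (Prod.mk.inj h).2.symm⟩
    · show ((r :: l) ++ [w]).Nodup
      rw [List.nodup_append]
      refine ⟨hn, by simp, ?_⟩
      rintro a ha c hc rfl
      rw [List.mem_singleton.1 hc] at ha
      exact hwl ha
    · simp [Dipath.last]
    · show (eds r (l ++ [w])).getLast? = _
      rw [eds_append, hl]
    · intro x hx
      have hx' : x ∈ (r :: l) ++ [w] := hx
      rcases List.mem_append.1 hx' with h | h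
      · right
        have := rch_to_last hc h
        rwa [hl] at this
      · exact Or.inl (List.mem_singleton.1 h)
  choose p hp1 hp2 hp3 hp4 using hex
  refine ⟨Set.range p, ⟨?_, ?_⟩, ?_⟩
  · rintro _ ⟨b, rfl⟩; exact ⟨hp1 b, hp2 b⟩
  · rintro _ ⟨b, rfl⟩ _ ⟨c, rfl⟩ hne x ⟨hx1, hx2⟩
    by_contra hx
    have hxr : x ≠ r := fun h => hx (Or.inl h)
    have hxw : x ≠ w := fun h => hx (Or.inr h)
    have h1 := (hp4 b x hx1).resolve_left hxw
    have h2 := (hp4 c x hx2).resolve_left hxw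
    have := rch_unique hG.sys hxr h1 h2 (hG.noout _ b.2) (hG.noout _ c.2)
    exact hne (by rw [Subtype.ext this])
  · ext e
    constructor
    · rintro ⟨_, ⟨b, rfl⟩, h⟩
      rw [hp3] at h
      rw [← Option.some.inj h]; exact b.2
    · intro he
      have he' : (e.1, w) ∈ I := by rw [← hIm e he]; exact he
      exact ⟨_, ⟨⟨e.1, he'⟩, rfl⟩, (hp3 _).trans (congrArg some (hIm e he).symm)⟩

theorem chain_sep {E : Set (V × V)} {M : Set V} {a : V} {l : List V}
    (hc : List.IsChain (fun a b => (a, b) ∈ E) (a :: l)) (ha : a ∈ M)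
    (hl : (a :: l).getLast (List.cons_ne_nil _ _) ∉ M) :
    ∃ s ∈ a :: l, s ∉ M ∧ ∃ z ∈ M, (z, s) ∈ E := by
  induction l generalizing a with
  | nil => exact absurd ha hl
  | cons b l ih =>
    rw [List.isChain_cons_cons] at hc
    by_cases hb : b ∈ M
    · rw [List.getLast_cons (List.cons_ne_nil _ _)] at hl
      obtain ⟨s, hs, h⟩ := ih hc.2 hb hl
      exact ⟨s, List.mem_cons_of_mem _ hs, h⟩
    · exact ⟨b, by simp, hb, a, ha, hc.1⟩

theorem fine_concl {E : Set (V × V)} {r u v : V} {M : Set V} {F : Set (V × V)}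
    (h : Fine E r u v M F) : ∃ S : Set V, r ∉ S ∧ v ∈ S ∧
      ∃ P : Set (Dipath E), IsRSSystem E r S P ∧ termVerts P = S ∧
        (∀ e ∈ E, e.2 = v → e ≠ (u, v) → SeparatesFrom E r S e.1) ∧
        ∃ p ∈ P, p.lastEdge? = some (u, v) := by
  set S : Set V := {s | s ∉ M ∧ ∃ a ∈ M, (a, s) ∈ E} with hS
  have hout : ∀ s ∈ S, ∀ d, (s, d) ∉ F := fun s hs d hd => hs.1 (h.tl _ hd)
  have hvS : v ∈ S := ⟨h.vM, u, h.uM, h.sub h.uv⟩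
  have hex : ∀ s : S, ∃ p : Dipath E, p.start = r ∧ p.last = s.1 ∧
      List.IsChain (fun a b => (a, b) ∈ F) (p.start :: p.rest) := by
    rintro ⟨s, hs, a, ha, has⟩
    obtain ⟨l, hc, hn, hl⟩ := rch_path (h.lk a s ha hs has)
    exact ⟨⟨r, l, hc.imp (fun a b h' => h.sub h'), hn⟩, rfl, hl, hc⟩
  choose p hp1 hp2 hp3 using hex
  refine ⟨S, fun hr => hr.1 h.rM, hvS, Set.range p, ⟨?_, ?_⟩, ?_, ?_, ?_⟩
  · rintro _ ⟨s, rfl⟩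
    refine ⟨hp1 s, by rw [hp2]; exact s.2, ?_⟩
    intro x hx hxS
    obtain ⟨z, hz⟩ := chain_out (hp3 s) hx
    exact hout x hxS z hz
  · rintro _ ⟨s, rfl⟩ _ ⟨t, rfl⟩ hne x ⟨hx1, hx2⟩
    by_contra hxr
    have h1 : Rch F x (p s).last := rch_to_last (hp3 s) hx1
    have h2 : Rch F x (p t).last := rch_to_last (hp3 t) hx2
    rw [hp2] at h1 h2
    have := rch_unique h.sys hxr h1 h2 (hout _ s.2) (hout _ t.2)
    exact hne (by rw [Subtype.ext this])
  · ext s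
    constructor
    · rintro ⟨_, ⟨t, rfl⟩, rfl⟩
      rw [hp2]; exact t.2
    · intro hs
      exact ⟨_, ⟨⟨s, hs⟩, rfl⟩, hp2 _⟩
  · rintro ⟨x, y⟩ he rfl hne q hq1 hq2
    have hxM := h.sep x he (fun hxu => hne (by rw [hxu]))
    have hq2' : (q.start :: q.rest).getLast (List.cons_ne_nil _ _) = x := hq2
    obtain ⟨s, hs, hs'⟩ := chain_sep (M := M) q.isChain (by rw [hq1]; exact h.rM)
      (by rw [hq2']; exact hxM)
    exact ⟨s, hs, hs'⟩
  · refine ⟨_, ⟨⟨v, hvS⟩, rfl⟩, ?_⟩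
    set q := p ⟨v, hvS⟩ with hq
    have hq1 : q.start = r := hp1 _
    have hq2 : q.last = v := hp2 _
    have hq3 := hp3 ⟨v, hvS⟩
    rw [← hq] at hq3
    rcases List.eq_nil_or_concat q.rest with h0 | ⟨l, z, h0⟩
    · simp only [Dipath.last, h0, List.getLast_singleton] at hq2
      exact absurd (hq2.symm.trans hq1 ▸ h.rM) h.vM
    · rw [List.concat_eq_append] at h0
      have h1 : q.lastEdge? = some ((q.start :: l).getLast (List.cons_ne_nil _ _), z) := by
        show (eds q.start q.rest).getLast? = _
        rw [h0]; exact eds_append _ _ _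
      obtain ⟨h2, h3, -⟩ := q.lastEdge_spec h1
      have h4 := eds_mem hq3 h3
      rw [hq2] at h2
      subst h2
      rw [h1, h.sys.inj _ _ _ h4 h.uv]


/-- The "bubble" lemma: if `I ∈ 𝒢_D(w)` is extendable by any single new ingoing edge
of `w`, and deleting an edge `uv` (with `u ≠ r`, `v ≠ w`) destroys `I ∈ 𝒢(w)`, then
there is a set `S ∋ v` fully reachable by an `(r,S)`-path-system which separates the
tails of the other ingoing edges of `v` from `r`; in particular `uv` is the last
edge of a path of the system. -/
theorem stmt11 {V : Type u} (E : Set (V × V)) (r w u v : V) (hw : w ≠ r)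
    (hrw : (r, w) ∉ E) (I : Set (V × V)) (hI : I ∈ GSet E r w)
    (hext : ∀ f ∈ inEdges E w \ I, insert f I ∈ GSet E r w)
    (huv : (u, v) ∈ E) (hu : u ≠ r) (hv : v ≠ w)
    (hIuv : I ∉ GSet (E \ {(u, v)}) r w) :
    ∃ S : Set V, r ∉ S ∧ v ∈ S ∧
      ∃ P : Set (Dipath E), IsRSSystem E r S P ∧ termVerts P = S ∧
        (∀ e ∈ E, e.2 = v → e ≠ (u, v) → SeparatesFrom E r S e.1) ∧
        ∃ p ∈ P, p.lastEdge? = some (u, v) := by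
  obtain ⟨hIs, R, hR⟩ := gset_lk hw hrw hI
  have hr : r ∉ {b | (b, w) ∈ I} := fun h => hrw (hIs h).1
  obtain ⟨M, F, hF⟩ := graph_main hr hR
    (fun ⟨G, hG⟩ => hIuv (lk_gset hw hv hIs hG)) hu hw huv hv hrw (fun b hb => (hIs hb).1)
    (by
      intro y hy hyB
      obtain ⟨-, Ry, hRy⟩ := gset_lk hw hrw (hext (y, w) ⟨⟨hy, rfl⟩, hyB⟩)
      refine ⟨Ry, ?_⟩
      have : insert y {b | (b, w) ∈ I} = {b | (b, w) ∈ insert (y, w) I} := by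
        ext b; simp
      rw [this]; exact hRy)
  exact fine_concl hF
end

section
/- Let D be a rooted digraph and G ⊆ D a spanning subdigraph. Suppose that for every edge uv ∈ E(D)\E(G) there exists I ∈ 𝒢_G(v) such that I+uv ∉ 𝒢_{G+uv}(v). Then every spanning subdigraph H of G that is G-large is also D-large. -/
/-!  Common framework: digraphs as edge sets on a vertex type, directed paths,
path-systems, separations, flames and largeness. -/

universe u

variable {V : Type u}

/-- A path given by a function on an initial segment of the naturals. -/
def FP (R : V → V → Prop) (a b : V) (n : ℕ) (f : ℕ → V) : Prop :=
  f 0 = a ∧ f n = b ∧ (∀ i, i < n → R (f i) (f (i+1))) ∧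
    ∀ i j, i ≤ n → j ≤ n → f i = f j → i = j

theorem Dipath.toFP {E : Set (V × V)} (p : Dipath E) :
    ∃ n f, FP (fun a b => (a, b) ∈ E) p.start p.last n f ∧
      (∀ y, y ∈ p.support ↔ ∃ i, i ≤ n ∧ f i = y) ∧
      (p.lastEdge? = if n = 0 then none else some (f (n-1), f n)) := by
  obtain ⟨a, l, hc, hn⟩ := p
  have hc' : List.IsChain (fun a b => (a, b) ∈ E) (a :: l) := hc
  refine ⟨l.length, fun i => (a :: l).getD i a, ⟨?_, ?_, ?_, ?_⟩, ?_, ?_⟩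
  · simp
  · simp [Dipath.last, List.getLast_eq_getElem]
  · intro i hi
    have := List.isChain_iff_getElem.mp hc' i (by simp; omega)
    dsimp only
    rw [List.getD_eq_getElem _ _ (by simp; omega), List.getD_eq_getElem _ _ (by simp; omega)]
    exact this
  · intro i j hi hj h
    dsimp only at h
    rw [List.getD_eq_getElem _ _ (by simp; omega), List.getD_eq_getElem _ _ (by simp; omega)] at h
    exact (List.Nodup.getElem_inj_iff hn).mp h
  · intro y
    simp only [Dipath.support, Dipath.verts, Set.mem_ofPred_eq, List.mem_iff_getElem]
    constructor
    · rintro ⟨i, hi, rfl⟩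
      refine ⟨i, by simp at hi; omega, List.getD_eq_getElem _ _ hi⟩
    · rintro ⟨i, hi, rfl⟩
      exact ⟨i, by simp; omega, (List.getD_eq_getElem _ _ (by simp; omega)).symm⟩
  · simp only [Dipath.lastEdge?, Dipath.edges, Dipath.verts]
    rw [List.getLast?_eq_getElem?]
    split_ifs with h
    · have : l = [] := List.length_eq_zero_iff.mp h
      subst this; simp
    · rw [List.getElem?_eq_getElem (by simp; omega)]
      simp only [List.length_zip, List.length_cons, List.getElem_zip, Option.some.injEq]
      rw [List.getD_eq_getElem _ _ (by simp), List.getD_eq_getElem _ _ (by simp)]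
      rw [Prod.mk.injEq]
      constructor
      · congr 1; simp
      · rw [← List.getElem_cons_succ (a := a) (h := by simp; omega)]
        congr 1; simp; omega

theorem FP.toDipath {E : Set (V × V)} {a b : V} {n : ℕ} {f : ℕ → V}
    (h : FP (fun a b => (a, b) ∈ E) a b n f) :
    ∃ p : Dipath E, p.start = a ∧ p.last = b ∧
      (∀ y, y ∈ p.support ↔ ∃ i, i ≤ n ∧ f i = y) ∧
      (p.lastEdge? = if n = 0 then none else some (f (n-1), f n)) := by
  obtain ⟨h0, h1, h2, h3⟩ := h
  have hv : f 0 :: (List.range n).map (fun i => f (i+1)) = (List.range (n+1)).map f := by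
    rw [List.range_succ_eq_map]; simp
  have hc : List.IsChain (fun a b => (a, b) ∈ E) (f 0 :: (List.range n).map (fun i => f (i+1))) := by
    rw [hv, List.isChain_iff_getElem]
    intro i hi
    simp at hi ⊢
    exact h2 i hi
  refine ⟨⟨f 0, (List.range n).map (fun i => f (i+1)), hc, ?_⟩, h0, ?_, ?_, ?_⟩
  · rw [hv]
    refine List.Nodup.map_on ?_ List.nodup_range
    intro x hx y hy
    simp at hx hy
    exact h3 x y (by omega) (by omega)
  · simp only [Dipath.last, hv]
    simp [List.getLast_eq_getElem, h1]
  · intro y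
    simp only [Dipath.support, Dipath.verts, hv]
    simp
  · simp only [Dipath.lastEdge?, Dipath.edges, Dipath.verts, hv]
    rw [List.getLast?_eq_getElem?]
    split_ifs with h
    · subst h; simp
    · rw [List.getElem?_eq_getElem (by simp; omega)]
      simp
      congr 1; omega

theorem FP.of_walk {R : V → V → Prop} {a b : V} (h : Relation.ReflTransGen R a b) :
    ∃ n f, FP R a b n f := by
  induction h with
  | refl => exact ⟨0, fun _ => a, rfl, rfl, by intro i hi; omega, by intro i j hi hj _; omega⟩
  | @tail b c _ hbc ih =>
    obtain ⟨n, f, h0, h1, h2, h3⟩ := ih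
    by_cases hc : ∃ i, i ≤ n ∧ f i = c
    · obtain ⟨i, hi, hic⟩ := hc
      exact ⟨i, f, h0, hic, fun j hj => h2 j (by omega), fun j k hj hk => h3 j k (by omega) (by omega)⟩
    · push Not at hc
      refine ⟨n+1, fun i => if i ≤ n then f i else c, ?_, ?_, ?_, ?_⟩
      · simpa using h0
      · simp
      · intro i hi
        rcases Nat.lt_or_ge i n with h | h
        · have h' : i + 1 ≤ n := h
          simpa [h.le, h'] using h2 i h
        · have : i = n := by omega
          subst this
          simpa [h1] using hbc
      · intro i j hi hj
        dsimp only
        split_ifs with h h' h'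
        · exact h3 i j h h'
        · intro e; exact absurd e (hc i h)
        · intro e; exact absurd e.symm (hc j h')
        · intro _; omega

theorem mkGSet {E : Set (V × V)} {r w : V} (hw : w ≠ r) {ι : Type*} (n : ι → ℕ) (f : ι → ℕ → V)
    (hf : ∀ i, FP (fun a b => (a, b) ∈ E) r w (n i) (f i))
    (hd : ∀ i j, i ≠ j → ∀ k l, k ≤ n i → l ≤ n j → f i k = f j l → f i k = r ∨ f i k = w) :
    {e | ∃ i, e = (f i (n i - 1), w)} ∈ GSet E r w := by
  choose p hp1 hp2 hp3 hp4 using fun i => (hf i).toDipath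
  have hn : ∀ i, n i ≠ 0 := by
    intro i h
    have h1 := (hf i).1
    have h2 := (hf i).2.1
    rw [h] at h2
    exact hw (h2.symm.trans h1)
  refine ⟨Set.range p, ⟨?_, ?_⟩, ?_⟩
  · rintro _ ⟨i, rfl⟩
    exact ⟨hp1 i, hp2 i⟩
  · rintro _ ⟨i, rfl⟩ _ ⟨j, rfl⟩ hij y ⟨hy1, hy2⟩
    have hij' : i ≠ j := fun h => hij (by rw [h])
    obtain ⟨k, hk, rfl⟩ := (hp3 i y).mp hy1
    obtain ⟨l, hl, hl'⟩ := (hp3 j _).mp hy2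
    exact hd i j hij' k l hk hl hl'.symm
  · ext e
    constructor
    · rintro ⟨_, ⟨i, rfl⟩, he⟩
      rw [hp4, if_neg (hn i), (hf i).2.1] at he
      exact ⟨i, (Option.some.inj he).symm⟩
    · rintro ⟨i, rfl⟩
      exact ⟨_, ⟨i, rfl⟩, by rw [hp4, if_neg (hn i), (hf i).2.1]⟩

theorem ofGSet {E : Set (V × V)} {r w : V} (hw : w ≠ r) {I : Set (V × V)} (hI : I ∈ GSet E r w) :
    ∃ (ι : Type u) (n : ι → ℕ) (f : ι → ℕ → V),
      (∀ i, FP (fun a b => (a, b) ∈ E) r w (n i) (f i)) ∧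
      (∀ i j, i ≠ j → ∀ k l, k ≤ n i → l ≤ n j → f i k = f j l → f i k = r ∨ f i k = w) ∧
      I = {e | ∃ i, e = (f i (n i - 1), w)} := by
  obtain ⟨P, ⟨hP1, hP2⟩, rfl⟩ := hI
  choose n f hf hs hl using fun p : P => p.1.toFP
  have hf' : ∀ i, FP (fun a b => (a, b) ∈ E) r w (n i) (f i) := by
    intro i
    have := hf i
    rwa [(hP1 i.1 i.2).1, (hP1 i.1 i.2).2] at this
  have hn : ∀ i, n i ≠ 0 := by
    intro i h
    have h1 := (hf' i).1
    have h2 := (hf' i).2.1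
    rw [h] at h2
    exact hw (h2.symm.trans h1)
  refine ⟨P, n, f, hf', ?_, ?_⟩
  · intro i j hij k l hk hl' h
    exact hP2 i.2 j.2 (fun h => hij (Subtype.ext h))
      ⟨(hs i _).mpr ⟨k, hk, rfl⟩, (hs j _).mpr ⟨l, hl', h.symm⟩⟩
  · ext e
    constructor
    · rintro ⟨p, hp, he⟩
      have := hl ⟨p, hp⟩
      rw [he, if_neg (hn _), (hf' _).2.1] at this
      exact ⟨⟨p, hp⟩, Option.some.inj this⟩
    · rintro ⟨i, rfl⟩
      exact ⟨i.1, i.2, by rw [hl, if_neg (hn i), (hf' i).2.1]⟩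

/-- Vertices that can be freed by at most `n` alternating steps. -/
def Fr (K : Set (V × V)) (r : V) (m : V → V) : ℕ → Set V
  | 0 => {r}
  | n+1 => Fr K r m n ∪ {u | ∃ z u', z ≠ r ∧ m z = u ∧ u' ∈ Fr K r m n ∧ (u' = z ∨ (u', z) ∈ K)}

theorem root_mem_Fr (K : Set (V × V)) (r : V) (m : V → V) (n : ℕ) : r ∈ Fr K r m n := by
  induction n with
  | zero => rfl
  | succ n ih => exact Or.inl ih

theorem aug (K : Set (V × V)) (r : V) (m : V → V)
    (hrel : ∀ z, z ≠ r → m z = z ∨ (m z, z) ∈ K)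
    (hinj : ∀ z z', z ≠ r → z' ≠ r → m z = m z' → m z ≠ r → z = z') :
    ∀ n x, x ∈ Fr K r m n → ∃ m' : V → V,
      (∀ z, z ≠ r → m' z = z ∨ (m' z, z) ∈ K) ∧
      (∀ z z', z ≠ r → z' ≠ r → m' z = m' z' → m' z ≠ r → z = z') ∧
      (∀ z, z ≠ r → m' z = x → x = r) ∧ {z | m' z ≠ m z}.Finite ∧
      (∀ z, m' z ≠ m z → m z ∈ Fr K r m n ∧ m' z ∈ Fr K r m n) := by
  classical
  intro n
  induction n with
  | zero =>
    intro x hx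
    exact ⟨m, hrel, hinj, fun _ _ _ => hx, by simp, by simp⟩
  | succ n ih =>
    intro x hx
    by_cases hxn : x ∈ Fr K r m n
    · obtain ⟨m', h1, h2, h3, h4, h5⟩ := ih x hxn
      exact ⟨m', h1, h2, h3, h4, fun z hz => ⟨Or.inl (h5 z hz).1, Or.inl (h5 z hz).2⟩⟩
    · rcases hx with hx | ⟨z0, u', hz0, hmz, hu', hr⟩
      · exact absurd hx hxn
      obtain ⟨m', h1, h2, h3, h4, h5⟩ := ih u' hu'
      have hxr : x ≠ r := fun h => hxn (h ▸ root_mem_Fr K r m n)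
      have hm0 : m' z0 = x := by
        by_contra h
        exact hxn (hmz ▸ (h5 z0 (by rwa [hmz])).1)
      refine ⟨Function.update m' z0 u', ?_, ?_, ?_, ?_, ?_⟩
      · intro z hz
        by_cases h : z = z0
        · subst h; simpa using hr
        · simpa [h] using h1 z hz
      · intro z z' hz hz' he hne
        by_cases h : z = z0 <;> by_cases h' : z' = z0
        · rw [h, h']
        · subst h
          simp only [Function.update_self, Function.update_of_ne h'] at he hne
          exact absurd (h3 z' hz' he.symm) hne
        · subst h'
          simp only [Function.update_self, Function.update_of_ne h] at he hne
          exact absurd (he.trans (h3 z hz he)) hne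
        · simp only [Function.update_of_ne h, Function.update_of_ne h'] at he hne
          exact h2 z z' hz hz' he hne
      · intro z hz he
        by_cases h : z = z0
        · subst h
          simp only [Function.update_self] at he
          exact absurd (he ▸ hu') hxn
        · simp only [Function.update_of_ne h] at he
          exact absurd (h2 z z0 hz hz0 (he.trans hm0.symm) (by rwa [he])) h
      · refine (h4.insert z0).subset ?_
        intro z hz
        by_cases h : z = z0
        · exact Or.inl h
        · right
          simpa [h] using hz
      · intro z hz
        by_cases h : z = z0
        · subst h
          exact ⟨Or.inr ⟨z, u', hz0, rfl, hu', hr⟩, by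
            rw [Function.update_self]; exact Or.inl hu'⟩
        · simp only [Function.update_of_ne h] at hz ⊢
          exact ⟨Or.inl (h5 z hz).1, Or.inl (h5 z hz).2⟩

/-- The union of the sets `Fr`. -/
def Free (K : Set (V × V)) (r : V) (m : V → V) : Set V := {x | ∃ n, x ∈ Fr K r m n}

theorem root_mem_Free (K : Set (V × V)) (r : V) (m : V → V) : r ∈ Free K r m := ⟨0, rfl⟩

theorem Free_step {K : Set (V × V)} {r : V} {m : V → V} {z u : V} (hz : z ≠ r)
    (hu : u ∈ Free K r m) (h : u = z ∨ (u, z) ∈ K) : m z ∈ Free K r m := by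
  obtain ⟨n, hn⟩ := hu
  exact ⟨n+1, Or.inr ⟨z, u, hz, rfl, hn, h⟩⟩

theorem linkage (K : Set (V × V)) (r : V) (m : V → V)
    (hrel : ∀ z, z ≠ r → m z = z ∨ (m z, z) ∈ K)
    (hinj : ∀ z z', z ≠ r → z' ≠ r → m z = m z' → m z ≠ r → z = z')
    (hfin : ∀ z, z ≠ r → m z = z ∨ ∃ k, m^[k] z = r)
    (T : Set V) (hTF : ∀ t ∈ T, t ∉ Free K r m) (hT : ∀ t ∈ T, m t ∈ Free K r m)
    (x : V) (hx : x ∈ Free K r m) :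
    ∃ (k : V → ℕ) (o : V → ℕ → V),
      (∀ t, t ∈ T ∨ t = x ∨ t = r → FP (fun a b => (a, b) ∈ K) r t (k t) (o t) ∧
        ∀ i, i ≤ k t → o t i ∈ Free K r m ∪ T) ∧
      (∀ t t', t ∈ T ∨ t = x ∨ t = r → t' ∈ T ∨ t' = x ∨ t' = r → t ≠ t' →
        ∀ i j, i ≤ k t → j ≤ k t' → o t i = o t' j → o t i = r) := by
  classical
  obtain ⟨N, hN⟩ := hx
  obtain ⟨m', h1, h2, h3, h4, h5⟩ := aug K r m hrel hinj N x hN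
  have hx : x ∈ Free K r m := ⟨N, hN⟩
  have hrF := root_mem_Free K r m
  have step : ∀ y, y ∈ Free K r m ∪ T → y ≠ r → m' y ∈ Free K r m := by
    intro y hy hyr
    by_cases h : m' y = m y
    · rw [h]
      rcases hy with hy | hy
      · exact Free_step hyr hy (Or.inl rfl)
      · exact hT y hy
    · exact ⟨N, (h5 y h).2⟩
  have hW : ∀ t, t ∈ T ∨ t = x ∨ t = r → t ∈ Free K r m ∪ T := by
    rintro t (h | rfl | rfl)
    · exact Or.inr h
    · exact Or.inl hx
    · exact Or.inl hrF
  have mem : ∀ a, (a ∈ T ∨ a = x ∨ a = r) → ∀ i, (∀ l, l < i → m'^[l] a ≠ r) →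
      m'^[i] a ∈ Free K r m ∪ T := by
    intro a ha i
    induction i with
    | zero => intro _; exact hW a ha
    | succ i ih =>
      intro h
      rw [Function.iterate_succ_apply']
      exact Or.inl (step _ (ih fun l hl => h l (by omega)) (h i (by omega)))
  have noret : ∀ a b, (a ∈ T ∨ a = x ∨ a = r) → (b ∈ T ∨ b = x ∨ b = r) → ∀ j,
      a ≠ r → (∀ l, l ≤ j + 1 → m'^[l] b ≠ r) → a ≠ m'^[j+1] b := by
    intro a b ha hb j har hj he
    rw [Function.iterate_succ_apply'] at he
    have hy := mem b hb j (fun l hl => hj l (by omega))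
    have hyr := hj j (by omega)
    have hF := step _ hy hyr
    rw [← he] at hF
    rcases ha with ha | rfl | rfl
    · exact hTF a ha hF
    · exact har (h3 _ hyr he.symm)
    · exact har rfl
  have claim : ∀ a b, (a ∈ T ∨ a = x ∨ a = r) → (b ∈ T ∨ b = x ∨ b = r) → ∀ i j,
      (∀ l, l ≤ i → m'^[l] a ≠ r) → (∀ l, l ≤ j → m'^[l] b ≠ r) → m'^[i] a = m'^[j] b →
      a = b ∧ i = j := by
    intro a b ha hb i
    induction i with
    | zero =>
      intro j hi hj he
      cases j with
      | zero => exact ⟨he, rfl⟩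
      | succ j => exact absurd he (noret a b ha hb j (hi 0 le_rfl) hj)
    | succ i ih =>
      intro j hi hj he
      cases j with
      | zero => exact absurd he.symm (noret b a hb ha i (hj 0 le_rfl) hi)
      | succ j =>
        have he' := he
        rw [Function.iterate_succ_apply', Function.iterate_succ_apply'] at he'
        have := ih j (fun l hl => hi l (by omega)) (fun l hl => hj l (by omega))
          (h2 _ _ (hi i (by omega)) (hj j (by omega)) he' (by
            rw [← Function.iterate_succ_apply' m']; exact hi (i+1) le_rfl))
        exact ⟨this.1, by omega⟩
  have reach : ∀ a, (a ∈ T ∨ a = x ∨ a = r) → ∃ k, m'^[k] a = r := by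
    intro a ha
    by_contra hcon
    push Not at hcon
    have inj : Function.Injective (fun i => m'^[i] a) := fun i j he =>
      (claim a a ha ha i j (fun l _ => hcon l) (fun l _ => hcon l) he).2
    have hfinp : ((fun i => m'^[i] a) ⁻¹' {z | m' z ≠ m z}).Finite := h4.preimage inj.injOn
    obtain ⟨M, hM⟩ := hfinp.bddAbove
    have hM' : ∀ i, M < i → m' (m'^[i] a) = m (m'^[i] a) := by
      intro i hi
      by_contra h
      exact absurd (hM (show i ∈ _ from h)) (by omega)
    have hk : ∀ k, m^[k] (m'^[M+1] a) = m'^[M+1+k] a := by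
      intro k
      induction k with
      | zero => rfl
      | succ k ih =>
        rw [Function.iterate_succ_apply', ih, ← hM' _ (by omega),
          ← Function.iterate_succ_apply' m']
        rfl
    rcases hfin (m'^[M+1] a) (hcon _) with h | ⟨k, h⟩
    · have h' := hk 1
      simp only [Function.iterate_one] at h'
      rw [h] at h'
      have := inj h'
      omega
    · rw [hk] at h
      exact hcon _ h
  let k : V → ℕ := fun a => if h : ∃ k, m'^[k] a = r then Nat.find h else 0
  have k1 : ∀ a, (a ∈ T ∨ a = x ∨ a = r) → m'^[k a] a = r := by
    intro a ha
    have h := reach a ha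
    simp only [k, dif_pos h]
    exact Nat.find_spec h
  have k2 : ∀ a, (a ∈ T ∨ a = x ∨ a = r) → ∀ l, l < k a → m'^[l] a ≠ r := by
    intro a ha l hl
    have h := reach a ha
    simp only [k, dif_pos h] at hl
    exact Nat.find_min h hl
  refine ⟨k, fun a i => m'^[k a - i] a, ?_, ?_⟩
  · intro t ht
    refine ⟨⟨by simpa using k1 t ht, by simp, ?_, ?_⟩, ?_⟩
    · intro i hi
      dsimp only
      have e : k t - i = (k t - (i+1)) + 1 := by omega
      rw [e, Function.iterate_succ_apply']
      have hne := k2 t ht (k t - (i+1)) (by omega)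
      rcases h1 _ hne with h | h
      · exfalso
        rw [← Function.iterate_succ_apply' m'] at h
        have := (claim t t ht ht _ _ (fun l hl => by
          by_cases hl' : l = k t - (i+1) + 1
          · rw [hl', Nat.add_one, h]; exact hne
          · exact k2 t ht l (by omega)) (fun l hl => k2 t ht l (by omega)) h).2
        omega
      · exact h
    · intro i j hi hj he
      dsimp only at he
      by_cases hi0 : i = 0
      · by_contra hij
        subst hi0
        rw [Nat.sub_zero, k1 t ht] at he
        exact k2 t ht (k t - j) (by omega) he.symm
      by_cases hj0 : j = 0
      · by_contra hij
        subst hj0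
        rw [Nat.sub_zero, k1 t ht] at he
        exact k2 t ht (k t - i) (by omega) he
      have := (claim t t ht ht _ _ (fun l hl => k2 t ht l (by omega))
        (fun l hl => k2 t ht l (by omega)) he).2
      omega
    · intro i hi
      exact mem t ht _ (fun l hl => k2 t ht l (by omega))
  · intro t t' ht ht' hne i j hi hj he
    dsimp only at he ⊢
    by_contra hr
    have hi0 : i ≠ 0 := by
      rintro rfl; exact hr (by simpa using k1 t ht)
    have hj0 : j ≠ 0 := by
      rintro rfl; exact hr (by rw [he]; simpa using k1 t' ht')
    exact hne (claim t t' ht ht' _ _ (fun l hl => k2 t ht l (by omega))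
      (fun l hl => k2 t' ht' l (by omega)) he).1

theorem FP.concat {R : V → V → Prop} {r t w : V} {k l : ℕ} {o g : ℕ → V} (C : Set V)
    (ho : FP R r t k o) (hoC : ∀ i, i ≤ k → o i ∈ C) (hg : FP R t w l g)
    (hgC : ∀ i, 0 < i → i ≤ l → g i ∉ C) (hl : 0 < l) :
    ∃ n f, FP R r w n f ∧ f (n-1) = g (l-1) ∧
      ∀ i, i ≤ n → (∃ a, a ≤ k ∧ f i = o a) ∨ ∃ b, 0 < b ∧ b ≤ l ∧ f i = g b := by
  obtain ⟨o0, o1, o2, o3⟩ := ho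
  obtain ⟨g0, g1, g2, g3⟩ := hg
  refine ⟨k + l, fun i => if i ≤ k then o i else g (i - k), ⟨?_, ?_, ?_, ?_⟩, ?_, ?_⟩
  · simpa using o0
  · have : ¬ (k + l ≤ k) := by omega
    simpa [this] using g1
  · intro i hi
    dsimp only
    rcases Nat.lt_trichotomy i k with h | h | h
    · rw [if_pos h.le, if_pos (by omega)]; exact o2 i h
    · subst h
      rw [if_pos le_rfl, if_neg (by omega), o1, ← g0]
      have := g2 0 hl
      simpa using this
    · rw [if_neg (by omega), if_neg (by omega)]
      have := g2 (i - k) (by omega)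
      rwa [show i - k + 1 = i + 1 - k by omega] at this
  · intro i j hi hj
    dsimp only
    split_ifs with h h' h'
    · exact o3 i j h h'
    · intro e; exact absurd (e ▸ hoC i h) (hgC _ (by omega) (by omega))
    · intro e; exact absurd (e ▸ hoC j h') (hgC _ (by omega) (by omega))
    · intro e
      have := g3 _ _ (by omega) (by omega) e
      omega
  · dsimp only
    split_ifs with h
    · have : l = 1 := by omega
      subst this
      simp [o1, g0]
    · congr 1; omega
  · intro i hi
    dsimp only
    split_ifs with h
    · exact Or.inl ⟨i, h, rfl⟩
    · exact Or.inr ⟨i - k, by omega, by omega, rfl⟩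

theorem crossing (G K : Set (V × V)) (r v : V) (hK : K = G \ {(r, v)}) (m : V → V)
    (hrel : ∀ z, z ≠ r → m z = z ∨ (m z, z) ∈ K)
    (hinj : ∀ z z', z ≠ r → z' ≠ r → m z = m z' → m z ≠ r → z = z')
    (hfin : ∀ z, z ≠ r → m z = z ∨ ∃ k, m^[k] z = r)
    (T : Set V) (hTF : ∀ t ∈ T, t ∉ Free K r m) (hT : ∀ t ∈ T, m t ∈ Free K r m)
    (hout : ∀ y ∈ Free K r m, ∀ z, (y, z) ∈ K → z ∈ Free K r m ∪ T)
    (x : V) (hx : x ∈ Free K r m) (w : V) (hw : w ∉ Free K r m ∪ T)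
    (I : Set (V × V)) (hI : I ∈ GSet G r w) : insert (x, w) I ∈ GSet (insert (x, w) G) r w := by
  classical
  have hrF := root_mem_Free K r m
  have hwr : w ≠ r := fun h => hw (by rw [h]; exact Or.inl hrF)
  obtain ⟨ι, n, f, hf, hd, rfl⟩ := ofGSet hwr hI
  obtain ⟨k, o, ho1, ho2⟩ := linkage K r m hrel hinj hfin T hTF hT x hx
  have hsplit : ∀ i, ∃ j, j < n i ∧ (f i j ∈ T ∨ f i j = r) ∧
      ∀ j', j < j' → j' ≤ n i → f i j' ∉ Free K r m ∪ T := by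
    intro i
    obtain ⟨q0, q1, q2, q3⟩ := hf i
    let Pr : ℕ → Prop := fun j => f i j ∈ Free K r m ∪ T
    have hP0 : Pr 0 := by
      change f i 0 ∈ _
      rw [q0]; exact Or.inl hrF
    have hs : Pr (Nat.findGreatest Pr (n i)) := Nat.findGreatest_spec (Nat.zero_le _) hP0
    have hle : Nat.findGreatest Pr (n i) ≤ n i := Nat.findGreatest_le _
    have hgt : ∀ j', Nat.findGreatest Pr (n i) < j' → j' ≤ n i → f i j' ∉ Free K r m ∪ T :=
      fun j' h1 h2 => Nat.findGreatest_is_greatest h1 h2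
    generalize Nat.findGreatest Pr (n i) = j at hs hle hgt
    have hlt : j < n i := by
      refine lt_of_le_of_ne hle ?_
      rintro rfl
      apply hw
      rw [← q1]; exact hs
    refine ⟨j, hlt, ?_, hgt⟩
    rcases hs with hs | hs
    · right
      by_contra hne
      have he := q2 j hlt
      refine hgt (j+1) (by omega) (by omega) (hout _ hs _ ?_)
      rw [hK]
      refine ⟨he, fun h => hne ?_⟩
      exact (Prod.ext_iff.mp h).1
    · exact Or.inl hs
  choose j hj1 hj2 hj3 using hsplit
  let t : Option ι → V := fun a => a.elim x (fun i => f i (j i))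
  let l : Option ι → ℕ := fun a => a.elim 1 (fun i => n i - j i)
  let g : Option ι → ℕ → V := fun a => a.elim (fun b => if b = 0 then x else w)
    (fun i b => f i (j i + b))
  have hxw : x ≠ w := fun h => hw (h ▸ Or.inl hx)
  have ht : ∀ a, t a ∈ T ∨ t a = x ∨ t a = r := by
    rintro (_ | i)
    · exact Or.inr (Or.inl rfl)
    · rcases hj2 i with h | h
      · exact Or.inl h
      · exact Or.inr (Or.inr h)
  have hl : ∀ a, 0 < l a := by
    rintro (_ | i)
    · exact Nat.one_pos
    · have := hj1 i
      change 0 < n i - j i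
      omega
  have hg : ∀ a, FP (fun a b => (a, b) ∈ insert (x, w) G) (t a) w (l a) (g a) := by
    rintro (_ | i)
    · refine ⟨rfl, rfl, ?_, ?_⟩
      · intro i hi
        have : i = 0 := by change i < 1 at hi; omega
        subst this
        exact Or.inl rfl
      · intro i j hi hj h
        change i ≤ 1 at hi
        change j ≤ 1 at hj
        simp only [g, Option.elim] at h
        split_ifs at h <;> first | omega | exact absurd h hxw | exact absurd h.symm hxw
    · obtain ⟨q0, q1, q2, q3⟩ := hf i
      have hji := hj1 i
      refine ⟨rfl, ?_, ?_, ?_⟩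
      · change f i (j i + (n i - j i)) = w
        rw [show j i + (n i - j i) = n i by omega, q1]
      · intro b hb
        change b < n i - j i at hb
        exact Or.inr (q2 (j i + b) (by omega))
      · intro b c hb hc h
        change b ≤ n i - j i at hb
        change c ≤ n i - j i at hc
        have := q3 _ _ (by omega) (by omega) h
        omega
  have hgC : ∀ a, ∀ b, 0 < b → b ≤ l a → g a b ∉ Free K r m ∪ T := by
    rintro (_ | i) b hb hbl
    · simp only [g, Option.elim]
      rwa [if_neg (by omega)]
    · change b ≤ n i - j i at hbl
      exact hj3 i _ (by omega) (by omega)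
  have hgd : ∀ a a', a ≠ a' → ∀ b b', 0 < b → b ≤ l a → 0 < b' → b' ≤ l a' → g a b = g a' b' →
      g a b = r ∨ g a b = w := by
    rintro (_ | i) (_ | i') hne b b' hb hbl hb' hbl' h
    · exact absurd rfl hne
    · right
      simp only [g, Option.elim]
      rw [if_neg (by omega)]
    · right
      rw [h]
      simp only [g, Option.elim]
      rw [if_neg (by omega)]
    · change b ≤ n i - j i at hbl
      change b' ≤ n i' - j i' at hbl'
      have := hj1 i
      have := hj1 i'
      exact hd i i' (fun h => hne (by rw [h])) _ _ (by omega) (by omega) h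
  have htd : ∀ a a', a ≠ a' → t a = t a' → t a = r := by
    have hxi : ∀ i, x = f i (j i) → x = r := by
      intro i h
      rcases hj2 i with h' | h'
      · exact absurd hx (hTF x (h ▸ h'))
      · exact h.trans h'
    rintro (_ | i) (_ | i') hne h
    · exact absurd rfl hne
    · exact hxi i' h
    · change f i (j i) = x at h
      change f i (j i) = r
      rw [h]; exact hxi i h.symm
    · rcases hj2 i with h' | h'
      · rcases hd i i' (fun h => hne (by rw [h])) _ _ (hj1 i).le (hj1 i').le h with h'' | h''
        · exact h''
        · exact absurd (h'' ▸ Or.inr h') hw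
      · exact h'
  have hmono : ∀ a, FP (fun a b => (a, b) ∈ insert (x, w) G) r (t a) (k (t a)) (o (t a)) := by
    intro a
    obtain ⟨⟨q0, q1, q2, q3⟩, _⟩ := ho1 (t a) (ht a)
    refine ⟨q0, q1, fun i hi => Or.inr ?_, q3⟩
    have := q2 i hi
    rw [hK] at this
    exact this.1
  choose n' f' hf' hlast hsup using fun a =>
    (hmono a).concat (Free K r m ∪ T) (ho1 (t a) (ht a)).2 (hg a) (hgC a) (hl a)
  have key := mkGSet hwr n' f' hf' (by
    intro a a' hne c c' hc hc' h
    rcases hsup a c hc with ⟨b, hb, e⟩ | ⟨b, hb0, hb, e⟩ <;>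
      rcases hsup a' c' hc' with ⟨b', hb', e'⟩ | ⟨b', hb0', hb', e'⟩
    · left
      by_cases htt : t a = t a'
      · have hr := htd a a' hne htt
        have q := (ho1 (t a) (ht a)).1
        rw [hr] at q hb e
        have : k r = 0 := (q.2.2.2 0 (k r) (by omega) le_rfl (q.1.trans q.2.1.symm)).symm
        rw [e, show b = 0 by omega, q.1]
      · rw [e]
        exact ho2 _ _ (ht a) (ht a') htt b b' hb hb' (by rw [← e, ← e', h])
    · exfalso
      apply hgC a' b' hb0' hb'
      rw [← e', ← h, e]
      exact (ho1 (t a) (ht a)).2 b hb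
    · exfalso
      apply hgC a b hb0 hb
      rw [← e, h, e']
      exact (ho1 (t a') (ht a')).2 b' hb'
    · rw [e]
      exact hgd a a' hne b b' hb0 hb hb0' hb' (by rw [← e, ← e', h]))
  convert key using 1
  ext e
  have hsome : ∀ i, f' (some i) (n' (some i) - 1) = f i (n i - 1) := by
    intro i
    rw [hlast]
    have := hj1 i
    change f i (j i + (n i - j i - 1)) = _
    congr 1; omega
  have hnone : f' none (n' none - 1) = x := hlast none
  constructor
  · rintro (rfl | ⟨i, rfl⟩)
    · exact ⟨none, by rw [hnone]⟩
    · exact ⟨some i, by rw [hsome]⟩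
  · rintro ⟨_ | i, rfl⟩
    · left; rw [hnone]
    · right; exact ⟨i, by rw [hsome]⟩

theorem direct (G : Set (V × V)) (r w : V) (hwr : w ≠ r) (I : Set (V × V)) (hI : I ∈ GSet G r w) :
    insert (r, w) I ∈ GSet (insert (r, w) G) r w := by
  obtain ⟨ι, n, f, hf, hd, rfl⟩ := ofGSet hwr hI
  let g : ℕ → V := fun b => if b = 0 then r else w
  have hgv : ∀ b, g b = r ∨ g b = w := by
    intro b; simp only [g]; split_ifs <;> simp
  have key := mkGSet (E := insert (r, w) G) hwr (fun a : Option ι => a.elim 1 n)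
    (fun a => a.elim g f) (by
      rintro (_ | i)
      · refine ⟨rfl, rfl, ?_, ?_⟩
        · intro i hi
          have : i = 0 := by change i < 1 at hi; omega
          subst this
          exact Or.inl rfl
        · intro i j hi hj h
          change i ≤ 1 at hi
          change j ≤ 1 at hj
          simp only [g, Option.elim] at h
          split_ifs at h <;> first | omega | exact absurd h hwr | exact absurd h.symm hwr
      · obtain ⟨q0, q1, q2, q3⟩ := hf i
        exact ⟨q0, q1, fun b hb => Or.inr (q2 b hb), q3⟩)
    (by
      rintro (_ | i) (_ | i') hne b b' hb hb' h
      · exact absurd rfl hne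
      · exact hgv b
      · rw [h]; exact hgv b'
      · exact hd i i' (fun h => hne (by rw [h])) _ _ hb hb' h)
  convert key using 1
  ext e
  constructor
  · rintro (rfl | ⟨i, rfl⟩)
    · exact ⟨none, rfl⟩
    · exact ⟨some i, rfl⟩
  · rintro ⟨_ | i, rfl⟩
    · left; rfl
    · right; exact ⟨i, rfl⟩

theorem orth_sep (E G K : Set (V × V)) (r v : V) (hK : K = G \ {(r, v)}) (hv : v ≠ r)
    (h : ∀ e ∈ E \ G, ∃ I ∈ GSet G r e.2, insert e I ∉ GSet (insert e G) r e.2)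
    {ι : Type u} (n : ι → ℕ) (f : ι → ℕ → V)
    (hf : ∀ i, FP (fun a b => (a, b) ∈ K) r v (n i) (f i))
    (hd : ∀ i j, i ≠ j → ∀ k l, k ≤ n i → l ≤ n j → f i k = f j l → f i k = r ∨ f i k = v)
    (S : Set V) (hrS : r ∉ S) (hvS : v ∉ S)
    (hsep : ¬ Relation.ReflTransGen (fun a b => (a, b) ∈ K ∧ b ∉ S) r v)
    (hS1 : ∀ p, ∃ s, s ≤ n p ∧ ∀ i, i ≤ n p → f p i ∈ S → i = s)
    (hS2 : ∀ x ∈ S, ∃ p i, i ≤ n p ∧ f p i = x)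
    (hS3 : ∀ p, ∃ s, s ≤ n p ∧ f p s ∈ S) :
    ∃ T : Set V, r ∉ T ∧ v ∉ T ∧ (∀ p, ∃ s, s ≤ n p ∧ f p s ∈ T ∧ ∀ i, i ≤ n p → f p i ∈ T → i = s) ∧
      (∀ x ∈ T, ∃ p i, i ≤ n p ∧ f p i = x) ∧
      ∀ l q, FP (fun a b => (a, b) ∈ E \ {(r, v)}) r v l q → ∃ i, i ≤ l ∧ q i ∈ T := by
  classical
  let U : V → Prop := fun z => ∃ p i, 0 < i ∧ i < n p ∧ f p i = z
  let m : V → V := fun z => if hz : U z then f hz.choose (hz.choose_spec.choose - 1) else z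
  have notr : ∀ p i, 0 < i → i ≤ n p → f p i ≠ r := by
    intro p i h0 hi he
    have := (hf p).2.2.2 i 0 hi (by omega) (he.trans (hf p).1.symm)
    omega
  have notv : ∀ p i, i < n p → f p i ≠ v := by
    intro p i hi he
    have := (hf p).2.2.2 i (n p) hi.le le_rfl (he.trans (hf p).2.1.symm)
    omega
  have uniq : ∀ p p' i i', 0 < i → i < n p → i' ≤ n p' → f p i = f p' i' → p = p' ∧ i = i' := by
    intro p p' i i' h0 hi hi' he
    have hp : p = p' := by
      by_contra hne
      rcases hd p p' hne i i' hi.le hi' he with h | h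
      · exact notr p i h0 hi.le h
      · exact notv p i hi h
    subst hp
    exact ⟨rfl, (hf p).2.2.2 i i' hi.le hi' he⟩
  have mU : ∀ p i, 0 < i → i < n p → m (f p i) = f p (i-1) := by
    intro p i h0 hi
    have hz : U (f p i) := ⟨p, i, h0, hi, rfl⟩
    simp only [m, dif_pos hz]
    obtain ⟨hp, hi'⟩ := uniq p hz.choose i hz.choose_spec.choose h0 hi
      hz.choose_spec.choose_spec.2.1.le hz.choose_spec.choose_spec.2.2.symm
    exact (congrArg₂ (fun a b => f a (b - 1)) hp hi').symm
  have mN : ∀ z, ¬ U z → m z = z := by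
    intro z hz
    simp only [m, dif_neg hz]
  have hrel : ∀ z, z ≠ r → m z = z ∨ (m z, z) ∈ K := by
    intro z _
    by_cases hz : U z
    · obtain ⟨p, i, h0, hi, rfl⟩ := hz
      right
      rw [mU p i h0 hi]
      have := (hf p).2.2.1 (i-1) (by omega)
      rwa [show i - 1 + 1 = i by omega] at this
    · exact Or.inl (mN z hz)
  have hinj : ∀ z z', z ≠ r → z' ≠ r → m z = m z' → m z ≠ r → z = z' := by
    have aux : ∀ z z', U z → ¬ U z' → m z = m z' → m z = r := by
      rintro z z' ⟨p, i, h0, hi, rfl⟩ hz' he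
      rw [mN z' hz'] at he
      rw [mU p i h0 hi] at he ⊢
      by_cases h1 : i - 1 = 0
      · rw [h1]; exact (hf p).1
      · exact absurd ⟨p, i-1, by omega, by omega, he⟩ hz'
    intro z z' _ _ he hne
    by_cases hz : U z <;> by_cases hz' : U z'
    · obtain ⟨p, i, h0, hi, rfl⟩ := hz
      obtain ⟨p', i', h0', hi', rfl⟩ := hz'
      rw [mU p i h0 hi] at he hne
      rw [mU p' i' h0' hi'] at he
      have h1 : i - 1 ≠ 0 := by
        intro h1; rw [h1] at hne; exact hne (hf p).1
      obtain ⟨rfl, hh⟩ := uniq p p' (i-1) (i'-1) (by omega) (by omega) (by omega) he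
      rw [show i = i' by omega]
    · exact absurd (aux z z' hz hz' he) hne
    · exact absurd (he.trans (aux z' z hz' hz he.symm)) hne
    · rwa [mN z hz, mN z' hz'] at he
  have hfin : ∀ z, z ≠ r → m z = z ∨ ∃ k, m^[k] z = r := by
    intro z hzr
    clear hzr
    by_cases hz : U z
    · obtain ⟨p, i, h0, hi, rfl⟩ := hz
      right
      refine ⟨i, ?_⟩
      clear h0
      induction i with
      | zero => exact (hf p).1
      | succ i ih =>
        rw [Function.iterate_succ_apply, mU p (i+1) (by omega) hi]
        exact ih (by omega)
    · exact Or.inl (mN z hz)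
  have hrF := root_mem_Free K r m
  -- all free vertices are reachable from the root avoiding `S`
  have hFA : ∀ k x, x ∈ Fr K r m k →
      Relation.ReflTransGen (fun a b => (a, b) ∈ K ∧ b ∉ S) r x := by
    intro k
    induction k with
    | zero => rintro x rfl; exact .refl
    | succ k ih =>
      rintro x (hx | ⟨z, u, hz, rfl, hu, hr⟩)
      · exact ih x hx
      · have hzA : z ∉ S → Relation.ReflTransGen (fun a b => (a, b) ∈ K ∧ b ∉ S) r z := by
          intro hzS
          rcases hr with rfl | hr
          · exact ih _ hu
          · exact (ih u hu).tail ⟨hr, hzS⟩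
        by_cases hzU : U z
        · obtain ⟨p, i, h0, hi, rfl⟩ := hzU
          rw [mU p i h0 hi]
          obtain ⟨s, hs, hs'⟩ := hS1 p
          by_cases his : i ≤ s
          · have : ∀ c, c < s → Relation.ReflTransGen (fun a b => (a, b) ∈ K ∧ b ∉ S) r (f p c) := by
              intro c
              induction c with
              | zero => intro _; rw [(hf p).1]
              | succ c ihc =>
                intro hc
                refine (ihc (by omega)).tail ⟨(hf p).2.2.1 c (by omega), fun hS => ?_⟩
                have := hs' _ (by omega) hS
                omega
            exact this _ (by omega)
          · exfalso
            have hno : ∀ c, i ≤ c → c ≤ n p → f p c ∉ S := by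
              intro c hc hcn hS
              have := hs' c hcn hS
              omega
            have : ∀ c, i + c ≤ n p →
                Relation.ReflTransGen (fun a b => (a, b) ∈ K ∧ b ∉ S) r (f p (i + c)) := by
              intro c
              induction c with
              | zero => intro _; exact hzA (hno i le_rfl hi.le)
              | succ c ihc =>
                intro hc
                exact (ihc (by omega)).tail ⟨(hf p).2.2.1 (i+c) (by omega), hno _ (by omega) hc⟩
            have hh := this (n p - i) (by omega)
            rw [show i + (n p - i) = n p by omega, (hf p).2.1] at hh
            exact hsep hh
        · rw [mN z hzU]
          refine hzA fun hzS => hzU ?_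
          obtain ⟨p, i, hi, rfl⟩ := hS2 z hzS
          have h0 : i ≠ 0 := by rintro rfl; exact hz (hf p).1
          have h1 : i ≠ n p := by rintro rfl; exact hvS ((hf p).2.1 ▸ hzS)
          exact ⟨p, i, by omega, by omega, rfl⟩
  have hvF : v ∉ Free K r m := fun ⟨k, hk⟩ => hsep (hFA k v hk)
  let T : Set V := {t | U t ∧ t ∉ Free K r m ∧ m t ∈ Free K r m}
  have hout : ∀ y ∈ Free K r m, ∀ z, (y, z) ∈ K → z ∈ Free K r m ∪ T := by
    intro y hy z hyz
    by_cases hzr : z = r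
    · rw [hzr]; exact Or.inl hrF
    have hmz : m z ∈ Free K r m := Free_step hzr hy (Or.inr hyz)
    by_cases hzF : z ∈ Free K r m
    · exact Or.inl hzF
    · right
      refine ⟨?_, hzF, hmz⟩
      by_contra hU
      rw [mN z hU] at hmz
      exact hzF hmz
  have hdown : ∀ p i, i + 1 < n p → f p (i+1) ∈ Free K r m → f p i ∈ Free K r m := by
    intro p i hi hF
    have := Free_step (m := m) (notr p (i+1) (by omega) (by omega)) hF (Or.inl rfl)
    rwa [mU p (i+1) (by omega) hi] at this
  have hrange : ∀ k x, x ∈ Fr K r m k → x = r ∨ ∃ z, z ≠ r ∧ m z = x := by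
    intro k
    induction k with
    | zero => intro x hx; exact Or.inl hx
    | succ k ih =>
      rintro x (hx | ⟨z, u, hz, hm, _⟩)
      · exact ih x hx
      · exact Or.inr ⟨z, hz, hm⟩
  have hn2 : ∀ p, 2 ≤ n p := by
    intro p
    obtain ⟨s, hs, hsS⟩ := hS3 p
    have h0 : s ≠ 0 := by rintro rfl; exact hrS ((hf p).1 ▸ hsS)
    have h1 : s ≠ n p := by rintro rfl; exact hvS ((hf p).2.1 ▸ hsS)
    omega
  have hlastF : ∀ p, f p (n p - 1) ∉ Free K r m := by
    rintro p ⟨k, hk⟩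
    have := hn2 p
    rcases hrange k _ hk with h | ⟨z, hz, hm⟩
    · exact notr p (n p - 1) (by omega) (by omega) h
    · by_cases hzU : U z
      · obtain ⟨p', i, h0, hi, rfl⟩ := hzU
        rw [mU p' i h0 hi] at hm
        obtain ⟨rfl, hh⟩ := uniq p p' (n p - 1) (i-1) (by omega) (by omega) (by omega) hm.symm
        omega
      · rw [mN z hzU] at hm
        exact hzU ⟨p, n p - 1, by omega, by omega, hm.symm⟩
  refine ⟨T, fun hT => hT.2.1 hrF, ?_, ?_, ?_, ?_⟩
  · rintro ⟨⟨p, i, _, hi, he⟩, _⟩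
    exact notv p i hi he
  · intro p
    have hn := hn2 p
    have hex : ∃ i, f p i ∉ Free K r m := ⟨_, hlastF p⟩
    have hs : f p (Nat.find hex) ∉ Free K r m := Nat.find_spec hex
    have hmin : ∀ i, i < Nat.find hex → f p i ∈ Free K r m := fun i hi => by
      by_contra hh; exact Nat.find_min hex hi hh
    have hle : Nat.find hex ≤ n p - 1 := Nat.find_min' hex (hlastF p)
    generalize Nat.find hex = s at hs hmin hle
    have hs0 : s ≠ 0 := by
      rintro rfl
      rw [(hf p).1] at hs; exact hs hrF
    have hup : ∀ c, s + c < n p → f p (s + c) ∉ Free K r m := by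
      intro c
      induction c with
      | zero => intro _; exact hs
      | succ c ihc => intro hc hF; exact ihc (by omega) (hdown p (s+c) hc hF)
    refine ⟨s, by omega, ⟨⟨p, s, by omega, by omega, rfl⟩, hs, ?_⟩, ?_⟩
    · rw [mU p s (by omega) (by omega)]
      exact hmin _ (by omega)
    · rintro i hi ⟨⟨p', i', h0', hi', he⟩, hiF, hmi⟩
      obtain ⟨rfl, rfl⟩ := uniq p' p i' i h0' hi' hi he
      rw [mU _ _ h0' hi'] at hmi
      by_contra hne
      rcases Nat.lt_or_ge i' s with hlt | hge
      · exact hiF (hmin _ hlt)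
      · refine hup (i' - 1 - s) (by omega) ?_
        rwa [show s + (i' - 1 - s) = i' - 1 by omega]
  · rintro x ⟨⟨p, i, _, hi, he⟩, _⟩
    exact ⟨p, i, hi.le, he⟩
  · intro l q hq
    by_contra hcon
    push Not at hcon
    have hex : ∃ i, q i ∉ Free K r m := ⟨l, by rw [hq.2.1]; exact hvF⟩
    have hs : q (Nat.find hex) ∉ Free K r m := Nat.find_spec hex
    have hmin : ∀ i, i < Nat.find hex → q i ∈ Free K r m := fun i hi => by
      by_contra hh; exact Nat.find_min hex hi hh
    have hle : Nat.find hex ≤ l := Nat.find_min' hex (by rw [hq.2.1]; exact hvF)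
    generalize Nat.find hex = s at hs hmin hle
    obtain ⟨c, rfl⟩ : ∃ c, s = c + 1 := by
      cases s with
      | zero => exact absurd (by rw [hq.1]; exact hrF) hs
      | succ c => exact ⟨c, rfl⟩
    have he := hq.2.2.1 c (by omega)
    have hxF := hmin c (by omega)
    have hwT := hcon (c+1) hle
    have hw : q (c+1) ∉ Free K r m ∪ T := fun hh => hh.elim hs hwT
    by_cases hG : (q c, q (c+1)) ∈ G
    · exact hw (hout _ hxF _ (hK ▸ ⟨hG, he.2⟩))
    · obtain ⟨I, hI, hnI⟩ := h (q c, q (c+1)) ⟨he.1, hG⟩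
      exact hnI (crossing G K r v hK m hrel hinj hfin T (fun t ht => ht.2.1) (fun t ht => ht.2.2)
        hout _ hxF _ hw I hI)

/-- A path in a smaller digraph, seen in a larger one. -/
def Dipath.lift {E F : Set (V × V)} (hEF : E ⊆ F) (p : Dipath E) : Dipath F where
  start := p.start
  rest := p.rest
  chain := List.IsChain.imp (fun _ _ h => hEF h)
    (show List.IsChain (fun a b => (a, b) ∈ E) (p.start :: p.rest) from p.chain)
  nodup := p.nodup

/-- If for every edge `uv ∈ E(D) \ E(G)` there is an `I ∈ 𝒢_G(v)` with
`I + uv ∉ 𝒢_{G+uv}(v)`, then every `G`-large subdigraph of `G` is `D`-large. -/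
theorem stmt14 {V : Type u} (E : Set (V × V)) (r : V) (G : Set (V × V)) (hGE : G ⊆ E)
    (h : ∀ e ∈ E \ G, ∃ I ∈ GSet G r e.2, insert e I ∉ GSet (insert e G) r e.2)
    (H : Set (V × V)) (hHG : H ⊆ G) (hH : Large G r H) :
    Large E r H := by
  intro v hv
  obtain ⟨hrv, P, ⟨⟨hP1, hP2⟩, S, ⟨hrS, hvS, hsep⟩, hO1, hO2⟩, hPH⟩ := hH v hv
  refine ⟨?_, ?_⟩
  · intro hE
    apply hrv
    by_contra hG
    obtain ⟨I, hI, hnI⟩ := h (r, v) ⟨hE, hG⟩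
    exact hnI (direct G r v hv I hI)
  choose n f hf hs _ using fun p : P => p.1.toFP
  have hf' : ∀ i, FP (fun a b => (a, b) ∈ G \ {(r, v)}) r v (n i) (f i) := by
    intro i
    have := hf i
    rwa [(hP1 i.1 i.2).1, (hP1 i.1 i.2).2] at this
  obtain ⟨T, hrT, hvT, hT1, hT2, hT3⟩ := orth_sep E G (G \ {(r, v)}) r v rfl hv h n f hf'
    (by
      intro i j hij k l hk hl' he
      exact hP2 i.2 j.2 (fun h => hij (Subtype.ext h))
        ⟨(hs i _).mpr ⟨k, hk, rfl⟩, (hs j _).mpr ⟨l, hl', he.symm⟩⟩)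
    S hrS hvS
    (by
      intro hw
      obtain ⟨k, g, hg0, hg1, hg2, hg3⟩ := FP.of_walk hw
      obtain ⟨p, hp1, hp2, hp3, _⟩ := FP.toDipath (E := G \ {(r, v)})
        ⟨hg0, hg1, fun i hi => (hg2 i hi).1, hg3⟩
      obtain ⟨y, hy1, hy2⟩ := hsep p hp1 hp2
      obtain ⟨i, hi, rfl⟩ := (hp3 y).mp hy1
      cases i with
      | zero => rw [hg0] at hy2; exact hrS hy2
      | succ i => exact (hg2 i (by omega)).2 hy2)
    (by
      intro p
      obtain ⟨y, ⟨hy1, hy2⟩, hy3⟩ := hO1 p.1 p.2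
      obtain ⟨s, hs1, rfl⟩ := (hs p y).mp hy1
      refine ⟨s, hs1, fun i hi hiS => ?_⟩
      exact (hf p).2.2.2 _ _ hi hs1 (hy3 _ ⟨(hs p _).mpr ⟨i, hi, rfl⟩, hiS⟩))
    (by
      intro x hx
      obtain ⟨p, hp, hxp⟩ := hO2 x hx
      exact ⟨⟨p, hp⟩, (hs ⟨p, hp⟩ x).mp hxp⟩)
    (by
      intro p
      obtain ⟨y, ⟨hy1, hy2⟩, hy3⟩ := hO1 p.1 p.2
      obtain ⟨s, hs1, rfl⟩ := (hs p y).mp hy1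
      exact ⟨s, hs1, hy2⟩)
  have hsub : G \ {(r, v)} ⊆ E \ {(r, v)} := fun e he => ⟨hGE he.1, he.2⟩
  refine ⟨Dipath.lift hsub '' P, ⟨⟨?_, ?_⟩, T, ⟨hrT, hvT, ?_⟩, ?_, ?_⟩, ?_⟩
  · rintro _ ⟨p, hp, rfl⟩
    exact hP1 p hp
  · rintro _ ⟨p, hp, rfl⟩ _ ⟨q, hq, rfl⟩ hne
    exact hP2 hp hq (fun h => hne (by rw [h]))
  · intro p hp1 hp2
    obtain ⟨l, q, hq, hqs, _⟩ := p.toFP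
    rw [hp1, hp2] at hq
    obtain ⟨i, hi, hiT⟩ := hT3 l q hq
    exact ⟨q i, (hqs _).mpr ⟨i, hi, rfl⟩, hiT⟩
  · rintro _ ⟨p, hp, rfl⟩
    obtain ⟨s, hs1, hsT, hs3⟩ := hT1 ⟨p, hp⟩
    refine ⟨f ⟨p, hp⟩ s, ⟨(hs ⟨p, hp⟩ _).mpr ⟨s, hs1, rfl⟩, hsT⟩, ?_⟩
    rintro y ⟨hy1, hy2⟩
    obtain ⟨i, hi, rfl⟩ := (hs ⟨p, hp⟩ y).mp hy1
    rw [hs3 i hi hy2]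
  · intro x hx
    obtain ⟨p, hp⟩ := hT2 x hx
    exact ⟨_, ⟨p.1, p.2, rfl⟩, (hs p x).mpr hp⟩
  · rintro _ ⟨p, hp, rfl⟩
    exact hPH p hp
end
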